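/- arXiv:math/0307314 — 3 statements merged into one kernel-verified Lean document; each statement's English description precedes it below -/
import Mathlib

section
/- Let M be a topological space with basepoint x₀, and let H : M × [0,1] → M be a homotopy with H(x, 0) = x and H(x, 1) = x for all x ∈ M. Then the loop γ(t) = H(x₀, t) represents a central element of π₁(M, x₀): for every loop ℓ at x₀, the concatenation γ·ℓ is path-homotopic to ℓ·γ. -/
/-- If `H` is a homotopy from the identity of `M` to itself, then the loop
`γ(t) = H(x₀, t)` represents a central element of `π₁(M, x₀)`: for every loop `ℓ`
at `x₀`, the concatenation `γ·ℓ` is path-homotopic to `ℓ·γ`.  (Centrality of the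
Gottlieb subgroup `G(M, x₀)`.) -/
theorem gottlieb_central {M : Type} [TopologicalSpace M] (x₀ : M)
    (H : ContinuousMap.Homotopy (ContinuousMap.id M) (ContinuousMap.id M))
    (γ : Path x₀ x₀) (hγ : ∀ t : unitInterval, γ t = H (t, x₀)) :
    ∀ ℓ : Path x₀ x₀, (γ.trans ℓ).Homotopic (ℓ.trans γ) := by
  intro ℓ
  obtain rfl : γ = H.evalAt x₀ := Path.ext (funext hγ)
  exact (Path.Homotopic.map_trans_evalAt H ℓ).symm
end

section
/- Let B be a CW complex with a subcomplex M such that every cell of B not contained in M has dimension at least 4, let b₀ ∈ M be a 0-cell, and assume B and M are path-connected and πₙ(B, b₀) = 0 for all n ≥ 3. Let f : M → B be a continuous map with f(b₀) = b₀ inducing isomorphisms π₁(M, b₀) → π₁(B, b₀) and π₂(M, b₀) → π₂(B, b₀). Then every continuous map φ : B → B with φ|_M = f is a homotopy equivalence. -/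
open Metric Set

/-- A CW-complex structure on a topological space `X` (classical definition:
characteristic maps from closed balls whose open cells partition `X`,
closure-finiteness, weak topology). -/
structure CWStructure (X : Type) [TopologicalSpace X] : Type 1 where
  /-- the index set of `n`-cells -/
  cell : ℕ → Type
  /-- characteristic maps -/
  map : (n : ℕ) → cell n → PartialEquiv (Fin n → ℝ) X
  source_eq : ∀ n i, (map n i).source = ball 0 1
  continuousOn : ∀ n i, ContinuousOn (map n i) (closedBall 0 1)
  continuousOn_symm : ∀ n i, ContinuousOn (map n i).symm (map n i).target
  pairwiseDisjoint :
    (univ : Set (Σ n, cell n)).PairwiseDisjoint fun ni => map ni.1 ni.2 '' ball 0 1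
  mapsTo : ∀ n i, ∃ I : (m : ℕ) → Finset (cell m),
    MapsTo (map n i) (sphere 0 1)
      (⋃ (m : ℕ) (_ : m < n) (j ∈ I m), map m j '' closedBall 0 1)
  closed' : ∀ A : Set X, (∀ n i, IsClosed (A ∩ map n i '' closedBall 0 1)) → IsClosed A
  union' : ⋃ (n : ℕ), ⋃ (i : cell n), map n i '' closedBall 0 1 = univ

/-- `M` is a subcomplex of the CW complex `X` with CW structure `S`: a closed
subset which is the union of the closed cells indexed by `cells`. -/
structure CWSubcomplex {X : Type} [TopologicalSpace X] (S : CWStructure X) (M : Set X) where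
  cells : (n : ℕ) → Set (S.cell n)
  isClosed : IsClosed M
  union : ⋃ (n : ℕ), ⋃ (i ∈ cells n), S.map n i '' closedBall 0 1 = M

/-- `x` is (the image of) a `0`-cell of the CW complex. -/
def CWStructure.IsZeroCell {X : Type} [TopologicalSpace X] (S : CWStructure X) (x : X) : Prop :=
  ∃ i : S.cell 0, S.map 0 i 0 = x

/-- Every cell of `B` of dimension `< 4` is contained in `M`; equivalently, every
cell of `B` not contained in `M` has dimension at least `4`. -/
def CWStructure.LowCellsIn {X : Type} [TopologicalSpace X] (S : CWStructure X)
    (M : Set X) : Prop :=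
  ∀ n < 4, ∀ i : S.cell n, S.map n i '' closedBall 0 1 ⊆ M

/-- The inclusion of a subset as a continuous map. -/
def Set.incl {X : Type} [TopologicalSpace X] (M : Set X) : C(M, X) :=
  ⟨Subtype.val, continuous_subtype_val⟩

/-- Composition of a generalized loop with a pointed continuous map. -/
def GenLoop.push {N X Y : Type} [TopologicalSpace X] [TopologicalSpace Y]
    (f : C(X, Y)) {x : X} {y : Y} (hf : f x = y) (p : GenLoop N X x) : GenLoop N Y y :=
  ⟨f.comp p.1, fun t ht => by rw [ContinuousMap.comp_apply, p.2 t ht, hf]⟩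

/-- The map induced by a pointed continuous map on homotopy groups. -/
def HomotopyGroup.map (N : Type) {X Y : Type} [TopologicalSpace X] [TopologicalSpace Y]
    (f : C(X, Y)) {x : X} {y : Y} (hf : f x = y) :
    HomotopyGroup N X x → HomotopyGroup N Y y :=
  Quotient.map (GenLoop.push f hf)
    (fun _ _ h => Nonempty.map (fun H => H.compContinuousMap f) h)

open Function unitInterval
open scoped Topology Topology.Homotopy

theorem mem_closedBall_prod_real {V : Type*} [NormedAddCommGroup V] {x : V} {t : ℝ} :
    ((x, t) : V × ℝ) ∈ closedBall (0 : V × ℝ) 1 ↔ x ∈ closedBall (0 : V) 1 ∧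
      t ∈ Icc (-1 : ℝ) 1 := by
  simp [Prod.norm_def, abs_le]

theorem mem_sphere_prod_real {V : Type*} [NormedAddCommGroup V] {x : V} {t : ℝ} :
    ((x, t) : V × ℝ) ∈ sphere (0 : V × ℝ) 1 ↔
      (x ∈ sphere (0 : V) 1 ∧ t ∈ Icc (-1 : ℝ) 1) ∨
        (x ∈ closedBall (0 : V) 1 ∧ (t = -1 ∨ t = 1)) := by
  simp only [mem_sphere_zero_iff_norm, Prod.norm_def, Real.norm_eq_abs, mem_Icc,
    mem_closedBall_zero_iff, ← abs_le]
  rw [or_comm (a := t = -1), ← abs_eq zero_le_one]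
  constructor
  · intro h
    rcases max_choice ‖x‖ |t| with h' | h' <;> rw [h'] at h
    · exact Or.inl ⟨h, h ▸ h' ▸ le_max_right _ _⟩
    · exact Or.inr ⟨h ▸ h' ▸ le_max_left _ _, h⟩
  · rintro (⟨h, h'⟩ | ⟨h, h'⟩)
    · rw [h, max_eq_left h']
    · rw [h', max_eq_right h]

section HomotopyExtension

variable {V X : Type*} [NormedAddCommGroup V] [NormedSpace ℝ V] [TopologicalSpace X]

/-- The homotopy extension property of the pair (closed ball, sphere). -/
theorem exists_homotopy_extension {G : V → X} {H : V × ℝ → X}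
    (hG : ContinuousOn G (closedBall 0 1))
    (hH : ContinuousOn H (sphere 0 1 ×ˢ Icc 0 1))
    (h0 : ∀ x ∈ sphere (0 : V) 1, H (x, 0) = G x) :
    ∃ K : V × ℝ → X, ContinuousOn K (closedBall 0 1 ×ˢ Icc 0 1) ∧
      (∀ x ∈ closedBall (0 : V) 1, K (x, 0) = G x) ∧
      ∀ x ∈ sphere (0 : V) 1, ∀ t ∈ Icc (0 : ℝ) 1, K (x, t) = H (x, t) := by
  classical
  let K : V × ℝ → X := fun q =>
    if ‖q.1‖ ≤ 1 - q.2 / 2 then G ((1 - q.2 / 2)⁻¹ • q.1)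
    else H (‖q.1‖⁻¹ • q.1, 2 - (2 - q.2) / ‖q.1‖)
  have hcl : IsClosed (closedBall (0 : V) 1 ×ˢ Icc (0 : ℝ) 1) :=
    isClosed_closedBall.prod isClosed_Icc
  have hA : ContinuousOn K (closedBall 0 1 ×ˢ Icc 0 1 ∩ {q | ‖q.1‖ ≤ 1 - q.2 / 2}) := by
    refine ContinuousOn.congr (f := fun q : V × ℝ => G ((1 - q.2 / 2)⁻¹ • q.1)) ?_
      (fun q hq => if_pos hq.2)
    refine hG.comp ?_ ?_
    · refine ContinuousOn.smul (ContinuousOn.inv₀ (by fun_prop) ?_) (by fun_prop)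
      rintro ⟨x, t⟩ ⟨⟨-, ht⟩, -⟩
      simp only [mem_Icc] at ht ⊢
      linarith
    · rintro ⟨x, t⟩ ⟨⟨-, ht⟩, hx⟩
      simp only [mem_Icc, mem_ofPred_eq, mem_closedBall_zero_iff, norm_smul, norm_inv] at ht hx ⊢
      have : 0 < 1 - t / 2 := by linarith
      rw [Real.norm_of_nonneg this.le, inv_mul_le_iff₀ this]
      linarith
  have hB : ContinuousOn K (closedBall 0 1 ×ˢ Icc 0 1 ∩ {q | 1 - q.2 / 2 ≤ ‖q.1‖}) := by
    refine ContinuousOn.congr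
      (f := fun q : V × ℝ => H (‖q.1‖⁻¹ • q.1, 2 - (2 - q.2) / ‖q.1‖)) ?_ ?_
    · have hne : ∀ q ∈ closedBall (0 : V) 1 ×ˢ Icc (0 : ℝ) 1 ∩ {q | 1 - q.2 / 2 ≤ ‖q.1‖},
          ‖q.1‖ ≠ 0 := by
        rintro ⟨x, t⟩ ⟨⟨-, ht⟩, hx⟩
        simp only [mem_Icc, mem_ofPred_eq] at ht hx ⊢
        linarith
      refine hH.comp ?_ ?_
      · refine ContinuousOn.prodMk
          (ContinuousOn.smul (ContinuousOn.inv₀ (by fun_prop) hne) (by fun_prop))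
          (ContinuousOn.sub (by fun_prop) (ContinuousOn.div (by fun_prop) (by fun_prop) hne))
      · intro q hq
        have hq' := hne q hq
        obtain ⟨x, t⟩ := q
        obtain ⟨⟨hx1, ht⟩, hx⟩ := hq
        simp only [mem_Icc, mem_ofPred_eq, mem_closedBall_zero_iff] at ht hx hx1 hq'
        have hp : 0 < ‖x‖ := lt_of_le_of_ne (norm_nonneg _) hq'.symm
        refine ⟨?_, ?_, ?_⟩
        · simp [norm_smul, hq']
        · change 0 ≤ 2 - (2 - t) / ‖x‖
          rw [sub_nonneg, div_le_iff₀ hp]; linarith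
        · change 2 - (2 - t) / ‖x‖ ≤ 1
          have : 1 ≤ (2 - t) / ‖x‖ := by rw [le_div_iff₀ hp]; linarith
          linarith
    · rintro ⟨x, t⟩ ⟨⟨hx1, ht⟩, hx⟩
      simp only [mem_Icc, mem_ofPred_eq] at ht hx
      by_cases hle : ‖x‖ ≤ 1 - t / 2
      · have he : ‖x‖ = 1 - t / 2 := le_antisymm hle hx
        have hp : 0 < 1 - t / 2 := by linarith
        simp only [K, if_pos hle, he]
        have h2 : 2 - (2 - t) / (1 - t / 2) = 0 := by
          rw [sub_eq_zero, eq_div_iff hp.ne']; ring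
        rw [h2, h0]
        simp [norm_smul, he, abs_of_pos hp, hp.ne']
      · simp only [K, if_neg hle]
  refine ⟨K, ?_, ?_, ?_⟩
  · refine (hA.union_of_isClosed hB ?_ ?_).mono ?_
    · exact hcl.inter (isClosed_le (by fun_prop) (by fun_prop))
    · exact hcl.inter (isClosed_le (by fun_prop) (by fun_prop))
    · intro q hq
      rcases le_total ‖q.1‖ (1 - q.2 / 2) with h | h
      exacts [Or.inl ⟨hq, h⟩, Or.inr ⟨hq, h⟩]
  · intro x hx
    have : ‖x‖ ≤ 1 - 0 / 2 := by simpa using hx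
    simp only [K, if_pos this]
    simp
  · intro x hx t ht
    have hx1 : ‖x‖ = 1 := by simpa using hx
    by_cases hle : ‖x‖ ≤ 1 - t / 2
    · have : t = 0 := by linarith [ht.1]
      subst this
      simp only [K, if_pos hle]
      rw [h0 x hx]; simp
    · simp only [K, if_neg hle, hx1]
      norm_num

/-- Homotopy extension starting from the end of a homotopy. -/
theorem exists_homotopy_extension_backward {G : V → X} {H : V × ℝ → X}
    (hG : ContinuousOn G (closedBall 0 1))
    (hH : ContinuousOn H (sphere 0 1 ×ˢ Icc 0 1))
    (h1 : ∀ x ∈ sphere (0 : V) 1, H (x, 1) = G x) :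
    ∃ K : V × ℝ → X, ContinuousOn K (closedBall 0 1 ×ˢ Icc 0 1) ∧
      (∀ x ∈ closedBall (0 : V) 1, K (x, 1) = G x) ∧
      ∀ x ∈ sphere (0 : V) 1, ∀ t ∈ Icc (0 : ℝ) 1, K (x, t) = H (x, t) := by
  obtain ⟨K, hK, hK0, hKs⟩ := exists_homotopy_extension (H := fun q => H (q.1, 1 - q.2)) hG
    (hH.comp (by fun_prop) (by
      rintro ⟨x, t⟩ ⟨hx, ht⟩
      exact ⟨hx, by simpa using ht.2, by simpa using ht.1⟩)) (by simpa using h1)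
  refine ⟨fun q => K (q.1, 1 - q.2), hK.comp (by fun_prop) ?_, ?_, ?_⟩
  · rintro ⟨x, t⟩ ⟨hx, ht⟩
    exact ⟨hx, by simpa using ht.2, by simpa using ht.1⟩
  · simpa using hK0
  · intro x hx t ht
    simpa using hKs x hx (1 - t) ⟨by simpa using ht.2, by simpa using ht.1⟩

/-- Fillability of a map on the boundary of the prism `closedBall × [-1, 1]` is invariant under
homotopies of that map; the homotopy is given separately on the bottom, the top and the side. -/
theorem exists_prism_filling {bot top : V × ℝ → X} {side : (V × ℝ) × ℝ → X} {L : V × ℝ → X}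
    (hbot : ContinuousOn bot (closedBall 0 1 ×ˢ Icc 0 1))
    (htop : ContinuousOn top (closedBall 0 1 ×ˢ Icc 0 1))
    (hside : ContinuousOn side ((sphere 0 1 ×ˢ Icc (-1) 1) ×ˢ Icc 0 1))
    (hsb : ∀ x ∈ sphere (0 : V) 1, ∀ s ∈ Icc (0 : ℝ) 1, side ((x, -1), s) = bot (x, s))
    (hst : ∀ x ∈ sphere (0 : V) 1, ∀ s ∈ Icc (0 : ℝ) 1, side ((x, 1), s) = top (x, s))
    (hL : ContinuousOn L (closedBall 0 1))
    (hLb : ∀ x ∈ closedBall (0 : V) 1, L (x, -1) = bot (x, 1))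
    (hLt : ∀ x ∈ closedBall (0 : V) 1, L (x, 1) = top (x, 1))
    (hLs : ∀ x ∈ sphere (0 : V) 1, ∀ t ∈ Icc (-1 : ℝ) 1, L (x, t) = side ((x, t), 1)) :
    ∃ L' : V × ℝ → X, ContinuousOn L' (closedBall 0 1) ∧
      (∀ x ∈ closedBall (0 : V) 1, L' (x, -1) = bot (x, 0)) ∧
      (∀ x ∈ closedBall (0 : V) 1, L' (x, 1) = top (x, 0)) ∧
      ∀ x ∈ sphere (0 : V) 1, ∀ t ∈ Icc (-1 : ℝ) 1, L' (x, t) = side ((x, t), 0) := by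
  classical
  let H : (V × ℝ) × ℝ → X := fun q =>
    if q.1.2 = -1 then bot (q.1.1, q.2) else if q.1.2 = 1 then top (q.1.1, q.2) else side q
  have Hb : ∀ x s, H ((x, -1), s) = bot (x, s) := fun x s => by simp [H]
  have Ht : ∀ x s, H ((x, 1), s) = top (x, s) := fun x s => by
    simp only [H, if_true]; rw [if_neg (by norm_num)]
  have Hs : ∀ x ∈ sphere (0 : V) 1, ∀ t, ∀ s ∈ Icc (0 : ℝ) 1, H ((x, t), s) = side ((x, t), s) := by
    intro x hx t s hs
    by_cases h1 : t = -1
    · subst h1; rw [Hb, hsb x hx s hs]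
    by_cases h2 : t = 1
    · subst h2; rw [Ht, hst x hx s hs]
    simp [H, h1, h2]
  have hH : ContinuousOn H (sphere 0 1 ×ˢ Icc 0 1) := by
    have c1 : ContinuousOn H ((closedBall 0 1 ×ˢ {-1}) ×ˢ Icc 0 1) := by
      refine ContinuousOn.congr (f := fun q => bot (q.1.1, q.2)) (hbot.comp (by fun_prop) ?_) ?_
      · rintro ⟨⟨x, t⟩, s⟩ ⟨⟨hx, -⟩, hs⟩; exact ⟨hx, hs⟩
      · rintro ⟨⟨x, t⟩, s⟩ ⟨⟨hx, rfl⟩, hs⟩; exact Hb _ _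
    have c2 : ContinuousOn H ((closedBall 0 1 ×ˢ {1}) ×ˢ Icc 0 1) := by
      refine ContinuousOn.congr (f := fun q => top (q.1.1, q.2)) (htop.comp (by fun_prop) ?_) ?_
      · rintro ⟨⟨x, t⟩, s⟩ ⟨⟨hx, -⟩, hs⟩; exact ⟨hx, hs⟩
      · rintro ⟨⟨x, t⟩, s⟩ ⟨⟨hx, rfl⟩, hs⟩; exact Ht _ _
    have c3 : ContinuousOn H ((sphere 0 1 ×ˢ Icc (-1) 1) ×ˢ Icc 0 1) := by
      refine hside.congr ?_
      rintro ⟨⟨x, t⟩, s⟩ ⟨⟨hx, -⟩, hs⟩; exact Hs x hx t s hs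
    have i1 : IsClosed ((closedBall (0 : V) 1 ×ˢ {(-1 : ℝ)}) ×ˢ Icc (0 : ℝ) 1) :=
      (isClosed_closedBall.prod isClosed_singleton).prod isClosed_Icc
    have i2 : IsClosed ((closedBall (0 : V) 1 ×ˢ {(1 : ℝ)}) ×ˢ Icc (0 : ℝ) 1) :=
      (isClosed_closedBall.prod isClosed_singleton).prod isClosed_Icc
    have i3 : IsClosed ((sphere (0 : V) 1 ×ˢ Icc (-1 : ℝ) 1) ×ˢ Icc (0 : ℝ) 1) :=
      (isClosed_sphere.prod isClosed_Icc).prod isClosed_Icc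
    refine ((c1.union_of_isClosed c2 i1 i2).union_of_isClosed c3 (i1.union i2) i3).mono ?_
    rintro ⟨⟨x, t⟩, s⟩ ⟨h, hs⟩
    rcases mem_sphere_prod_real.1 h with ⟨hx, ht⟩ | ⟨hx, rfl | rfl⟩
    · exact Or.inr ⟨⟨hx, ht⟩, hs⟩
    · exact Or.inl (Or.inl ⟨⟨hx, rfl⟩, hs⟩)
    · exact Or.inl (Or.inr ⟨⟨hx, rfl⟩, hs⟩)
  obtain ⟨K, hK, -, hKs⟩ := exists_homotopy_extension_backward (G := L) hL hH (by
    rintro ⟨x, t⟩ h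
    rcases mem_sphere_prod_real.1 h with ⟨hx, ht⟩ | ⟨hx, rfl | rfl⟩
    · rw [Hs x hx t 1 (by simp), hLs x hx t ht]
    · rw [Hb, hLb x hx]
    · rw [Ht, hLt x hx])
  have z : (0 : ℝ) ∈ Icc (0 : ℝ) 1 := by simp
  refine ⟨fun q => K (q, 0), hK.comp (by fun_prop) (fun q hq => ⟨hq, z⟩), ?_, ?_, ?_⟩
  · intro x hx
    exact (hKs (x, -1) (mem_sphere_prod_real.2 (Or.inr ⟨hx, by simp⟩)) 0 z).trans (Hb _ _)
  · intro x hx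
    exact (hKs (x, 1) (mem_sphere_prod_real.2 (Or.inr ⟨hx, by simp⟩)) 0 z).trans (Ht _ _)
  · intro x hx t ht
    exact (hKs (x, t) (mem_sphere_prod_real.2 (Or.inl ⟨hx, ht⟩)) 0 z).trans (Hs x hx t 0 z)

end HomotopyExtension

section HELP

variable {V Y Z : Type*} [NormedAddCommGroup V]
  [TopologicalSpace Y] [TopologicalSpace Z]

/-- The map `g` from the sphere to `Y` extends to the ball, with `φ ∘ G` homotopic to `h`
relative to the sphere. -/
def CompressesAlong (φ : C(Y, Z)) (g : V → Y) (h : V → Z) : Prop :=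
  ∃ (G : V → Y) (L : V × ℝ → Z),
    ContinuousOn G (closedBall 0 1) ∧ ContinuousOn L (closedBall 0 1) ∧
    (∀ x ∈ sphere (0 : V) 1, G x = g x) ∧
    (∀ x ∈ closedBall (0 : V) 1, L (x, -1) = h x) ∧
    (∀ x ∈ closedBall (0 : V) 1, L (x, 1) = φ (G x)) ∧
    ∀ x ∈ sphere (0 : V) 1, ∀ t ∈ Icc (-1 : ℝ) 1, L (x, t) = h x

/-- The homotopy extension and lifting property of `φ` for the pair (ball, sphere) in `V`. -/
def HasHELP (V : Type*) [NormedAddCommGroup V] [NormedSpace ℝ V] (φ : C(Y, Z)) : Prop :=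
  ∀ (g : V → Y) (h : V → Z), ContinuousOn g (sphere 0 1) → ContinuousOn h (closedBall 0 1) →
    (∀ x ∈ sphere (0 : V) 1, h x = φ (g x)) → CompressesAlong φ g h

theorem CompressesAlong.congr {φ : C(Y, Z)} {g g' : V → Y} {h : V → Z}
    (H : CompressesAlong φ g h) (hg : ∀ x ∈ sphere (0 : V) 1, g x = g' x) :
    CompressesAlong φ g' h := by
  obtain ⟨G, L, h1, h2, h3, h4⟩ := H
  exact ⟨G, L, h1, h2, fun x hx => (h3 x hx).trans (hg x hx), h4⟩

variable [NormedSpace ℝ V]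

theorem CompressesAlong.of_homotopy {φ : C(Y, Z)} {γ : V × ℝ → Y} {h : V → Z}
    (hγ : ContinuousOn γ (sphere 0 1 ×ˢ Icc 0 1)) (hh : ContinuousOn h (closedBall 0 1))
    (hc : ∀ x ∈ sphere (0 : V) 1, h x = φ (γ (x, 0)))
    (H : ∀ h' : V → Z, ContinuousOn h' (closedBall 0 1) →
      (∀ x ∈ sphere (0 : V) 1, h' x = φ (γ (x, 1))) → CompressesAlong φ (fun x => γ (x, 1)) h') :
    CompressesAlong φ (fun x => γ (x, 0)) h := by
  have o : (1 : ℝ) ∈ Icc (0 : ℝ) 1 := by simp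
  have z : (0 : ℝ) ∈ Icc (0 : ℝ) 1 := by simp
  obtain ⟨K, hK, hK0, hKs⟩ := exists_homotopy_extension hh
    (φ.continuous.comp_continuousOn hγ) (fun x hx => (hc x hx).symm)
  obtain ⟨G, L, hG, hL, hGs, hLb, hLt, hLs⟩ := H (fun x => K (x, 1))
    (hK.comp (by fun_prop) fun x hx => ⟨hx, o⟩) (fun x hx => hKs x hx 1 o)
  obtain ⟨T, hT, hT1, hTs⟩ := exists_homotopy_extension_backward hG hγ
    (fun x hx => (hGs x hx).symm)
  obtain ⟨L', hL', hL'b, hL't, hL's⟩ := exists_prism_filling (bot := K)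
    (top := fun q => φ (T q)) (side := fun q => φ (γ (q.1.1, q.2))) hK
    (φ.continuous.comp_continuousOn hT)
    (φ.continuous.comp_continuousOn (hγ.comp (by fun_prop) fun q hq => ⟨hq.1.1, hq.2⟩))
    (fun x hx s hs => (hKs x hx s hs).symm) (fun x hx s hs => by rw [hTs x hx s hs])
    hL hLb (fun x hx => by rw [hLt x hx, hT1 x hx])
    (fun x hx t ht => (hLs x hx t ht).trans (hKs x hx 1 o))
  refine ⟨fun x => T (x, 0), L', hT.comp (by fun_prop) fun x hx => ⟨hx, z⟩, hL',
    fun x hx => hTs x hx 0 z, fun x hx => (hL'b x hx).trans (hK0 x hx), hL't, ?_⟩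
  intro x hx t ht
  rw [hL's x hx t ht, hc x hx]

theorem HasHELP.of_homeomorph {W : Type*} [NormedAddCommGroup W] [NormedSpace ℝ W] {φ : C(Y, Z)}
    (e : W ≃ₜ V) (he : ∀ x, ‖e x‖ = ‖x‖) (H : HasHELP W φ) : HasHELP V φ := by
  intro g h hg hh hc
  have he' : ∀ x, ‖e.symm x‖ = ‖x‖ := fun x => by rw [← he, e.apply_symm_apply]
  have m1 : MapsTo e (sphere 0 1) (sphere 0 1) := fun x hx => by simpa [he] using hx
  have m2 : MapsTo e (closedBall 0 1) (closedBall 0 1) := fun x hx => by simpa [he] using hx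
  have m1' : MapsTo e.symm (sphere 0 1) (sphere 0 1) := fun x hx => by simpa [he'] using hx
  have m2' : MapsTo e.symm (closedBall 0 1) (closedBall 0 1) := fun x hx => by simpa [he'] using hx
  obtain ⟨G, L, hG, hL, h1, h2, h3, h4⟩ := H (g ∘ e) (h ∘ e)
    (hg.comp e.continuous.continuousOn m1) (hh.comp e.continuous.continuousOn m2)
    (fun x hx => hc _ (m1 hx))
  refine ⟨G ∘ e.symm, fun q => L (e.symm q.1, q.2), hG.comp e.symm.continuous.continuousOn m2',
    hL.comp (by fun_prop) ?_, ?_, ?_, ?_, ?_⟩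
  · rintro ⟨x, t⟩ hx
    rw [mem_closedBall_prod_real] at hx
    exact mem_closedBall_prod_real.2 ⟨m2' hx.1, hx.2⟩
  · intro x hx; simpa using h1 _ (m1' hx)
  · intro x hx; simpa using h2 _ (m2' hx)
  · intro x hx; simpa using h3 _ (m2' hx)
  · intro x hx t ht; simpa using h4 _ (m1' hx) t ht

/-- A map on the boundary of `closedBall × [-1, 1]` to a path-connected space is homotopic to one
that is constant on the bottom and on the side. -/
theorem exists_homotopy_const_off_top [PathConnectedSpace Y] (y₀ : Y) {g : V × ℝ → Y}
    (hg : ContinuousOn g (sphere 0 1)) :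
    ∃ γ : (V × ℝ) × ℝ → Y, ContinuousOn γ (sphere 0 1 ×ˢ Icc 0 1) ∧
      (∀ x ∈ sphere (0 : V × ℝ) 1, γ (x, 0) = g x) ∧
      (∀ x ∈ closedBall (0 : V) 1, γ ((x, -1), 1) = y₀) ∧
      ∀ x ∈ sphere (0 : V) 1, ∀ t ∈ Icc (-1 : ℝ) 1, γ ((x, t), 1) = y₀ := by
  classical
  have o : (1 : ℝ) ∈ Icc (0 : ℝ) 1 := by simp
  have z : (0 : ℝ) ∈ Icc (0 : ℝ) 1 := by simp
  obtain ⟨K, hK, hK0, hKs⟩ := exists_homotopy_extension (G := fun x : V => g (x, -1))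
    (H := fun q => g (q.1, 2 * q.2 - 1))
    (hg.comp (by fun_prop) fun x hx => mem_sphere_prod_real.2 (Or.inr ⟨hx, by simp⟩))
    (hg.comp (by fun_prop) fun q hq => mem_sphere_prod_real.2 (Or.inl ⟨hq.1, by
      have := hq.2.1; have := hq.2.2; constructor <;> linarith⟩))
    (fun x hx => by norm_num)
  let G : V × ℝ → Y := fun q => K (q.1, (q.2 + 1) / 2)
  have hG : ContinuousOn G (closedBall 0 1) := hK.comp (by fun_prop) (by
    rintro ⟨x, t⟩ hx
    obtain ⟨hx, h1, h2⟩ := mem_closedBall_prod_real.1 hx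
    exact ⟨hx, by change 0 ≤ (t + 1) / 2; linarith, by change (t + 1) / 2 ≤ 1; linarith⟩)
  have hGb : ∀ x ∈ closedBall (0 : V) 1, G (x, -1) = g (x, -1) := fun x hx => by
    have := hK0 x hx
    simpa [G] using this
  have hGs : ∀ x ∈ sphere (0 : V) 1, ∀ t ∈ Icc (-1 : ℝ) 1, G (x, t) = g (x, t) := by
    intro x hx t ht
    have := hKs x hx ((t + 1) / 2) ⟨by linarith [ht.1], by linarith [ht.2]⟩
    simp only [G, this]
    congr 2; ring
  let P : Path (G 0) y₀ := PathConnectedSpace.somePath _ _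
  let N : (V × ℝ) × ℝ → Y := fun q =>
    if q.2 ≤ 1 / 2 then G ((1 - 2 * q.2) • q.1) else P.extend (2 * q.2 - 1)
  have hN : ContinuousOn N (closedBall 0 1 ×ˢ Icc 0 1) := by
    have c1 : ContinuousOn N (closedBall 0 1 ×ˢ Icc 0 (1 / 2)) := by
      refine ContinuousOn.congr (f := fun q => G ((1 - 2 * q.2) • q.1))
        (hG.comp (by fun_prop) ?_) (fun q hq => if_pos hq.2.2)
      rintro ⟨x, s⟩ ⟨hx, hs0, hs1⟩
      rw [mem_closedBall_zero_iff] at hx ⊢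
      simp only at hs0 hs1 hx ⊢
      rw [norm_smul, Real.norm_of_nonneg (by linarith)]
      nlinarith [norm_nonneg x]
    have c2 : ContinuousOn N (closedBall 0 1 ×ˢ Icc (1 / 2) 1) := by
      refine ContinuousOn.congr (f := fun q => P.extend (2 * q.2 - 1))
        (Continuous.continuousOn (P.continuous_extend.comp (by fun_prop))) ?_
      rintro ⟨x, s⟩ ⟨hx, hs0, hs1⟩
      simp only at hs0 hs1
      rcases hs0.eq_or_lt with rfl | h
      · simp [N]
      · simp only [N]; rw [if_neg (not_le.2 h)]
    refine (c1.union_of_isClosed c2 (isClosed_closedBall.prod isClosed_Icc)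
      (isClosed_closedBall.prod isClosed_Icc)).mono ?_
    rintro ⟨x, s⟩ ⟨hx, hs0, hs1⟩
    rcases le_total s (1 / 2) with h | h
    exacts [Or.inl ⟨hx, hs0, h⟩, Or.inr ⟨hx, h, hs1⟩]
  have hN0 : ∀ q, N (q, 0) = G q := fun q => by simp [N]
  have hN1 : ∀ q, N (q, 1) = y₀ := fun q => by
    simp only [N]; norm_num
  obtain ⟨T, hT, hT0, hTs⟩ := exists_homotopy_extension (G := fun x : V => g (x, 1))
    (H := fun q => N ((q.1, 1), q.2))
    (hg.comp (by fun_prop) fun x hx => mem_sphere_prod_real.2 (Or.inr ⟨hx, by simp⟩))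
    (hN.comp (by fun_prop) fun q hq =>
      ⟨mem_closedBall_prod_real.2 ⟨sphere_subset_closedBall hq.1, by simp⟩, hq.2⟩)
    (fun x hx => by rw [hN0, hGs x hx 1 (by simp)])
  let γ : (V × ℝ) × ℝ → Y := fun q => if q.1.2 = 1 then T (q.1.1, q.2) else N q
  have γt : ∀ x s, γ ((x, 1), s) = T (x, s) := fun x s => by simp [γ]
  have γb : ∀ x s, γ ((x, -1), s) = N ((x, -1), s) := fun x s => by
    simp only [γ]; rw [if_neg (by norm_num)]
  have γs : ∀ x ∈ sphere (0 : V) 1, ∀ t, ∀ s ∈ Icc (0 : ℝ) 1,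
      γ ((x, t), s) = N ((x, t), s) := by
    intro x hx t s hs
    by_cases h : t = 1
    · subst h; rw [γt, hTs x hx s hs]
    · simp [γ, h]
  refine ⟨γ, ?_, ?_, ?_, ?_⟩
  · have c1 : ContinuousOn γ ((closedBall 0 1 ×ˢ {1}) ×ˢ Icc 0 1) := by
      refine ContinuousOn.congr (f := fun q => T (q.1.1, q.2))
        (hT.comp (by fun_prop) fun q hq => ⟨hq.1.1, hq.2⟩) ?_
      rintro ⟨⟨x, t⟩, s⟩ ⟨⟨hx, rfl⟩, hs⟩; exact γt _ _
    have c2 : ContinuousOn γ ((closedBall 0 1 ×ˢ {-1} ∪ sphere 0 1 ×ˢ Icc (-1) 1) ×ˢ Icc 0 1) := by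
      refine ContinuousOn.congr (f := N) (hN.mono ?_) ?_
      · rintro ⟨⟨x, t⟩, s⟩ ⟨⟨hx, rfl⟩ | ⟨hx, ht⟩, hs⟩
        · exact ⟨mem_closedBall_prod_real.2 ⟨hx, by simp⟩, hs⟩
        · exact ⟨mem_closedBall_prod_real.2 ⟨sphere_subset_closedBall hx, ht⟩, hs⟩
      · rintro ⟨⟨x, t⟩, s⟩ ⟨⟨hx, rfl⟩ | ⟨hx, ht⟩, hs⟩
        exacts [γb _ _, γs x hx t s hs]
    refine (c1.union_of_isClosed c2
      ((isClosed_closedBall.prod isClosed_singleton).prod isClosed_Icc)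
      (((isClosed_closedBall.prod isClosed_singleton).union
        (isClosed_sphere.prod isClosed_Icc)).prod isClosed_Icc)).mono ?_
    rintro ⟨⟨x, t⟩, s⟩ ⟨h, hs⟩
    rcases mem_sphere_prod_real.1 h with ⟨hx, ht⟩ | ⟨hx, rfl | rfl⟩
    · exact Or.inr ⟨Or.inr ⟨hx, ht⟩, hs⟩
    · exact Or.inr ⟨Or.inl ⟨hx, rfl⟩, hs⟩
    · exact Or.inl ⟨⟨hx, rfl⟩, hs⟩
  · rintro ⟨x, t⟩ h
    rcases mem_sphere_prod_real.1 h with ⟨hx, ht⟩ | ⟨hx, rfl | rfl⟩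
    · rw [γs x hx t 0 z, hN0, hGs x hx t ht]
    · rw [γb, hN0, hGb x hx]
    · rw [γt, hT0 x hx]
  · intro x hx; rw [γb, hN1]
  · intro x hx t ht; rw [γs x hx t 1 o, hN1]

end HELP

section GenLoop

theorem GenLoop.continuous_push {N X Y : Type} [TopologicalSpace X] [TopologicalSpace Y]
    (f : C(X, Y)) {x : X} {y : Y} (hf : f x = y) :
    Continuous (GenLoop.push (N := N) f hf) :=
  ((ContinuousMap.continuous_postcomp f).comp continuous_subtype_val).subtype_mk _

theorem GenLoop.push_const {N X Y : Type} [TopologicalSpace X] [TopologicalSpace Y]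
    (f : C(X, Y)) {x : X} {y : Y} (hf : f x = y) :
    GenLoop.push f hf (GenLoop.const : GenLoop N X x) = GenLoop.const := by
  ext t
  exact hf

theorem GenLoop.joined_iff_homotopic {N X : Type} [TopologicalSpace X] {x : X}
    {p q : GenLoop N X x} : Joined p q ↔ GenLoop.Homotopic p q := by
  constructor
  · rintro ⟨γ⟩
    refine ⟨⟨⟨⟨fun s => γ s.1 s.2, ?_⟩, ?_, ?_⟩, ?_⟩⟩
    · exact ContinuousEval.continuous_eval.comp
        ((γ.continuous.comp continuous_fst).prodMk continuous_snd)
    · intro t; simp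
    · intro t; simp
    · intro s t ht
      exact ((γ s).2 t ht).trans (p.2 t ht).symm
  · rintro ⟨H⟩
    refine ⟨⟨⟨fun s => ⟨H.toHomotopy.curry s, fun t ht => ?_⟩, ?_⟩, ?_, ?_⟩⟩
    · exact (H.eq_fst s ht).trans (p.2 t ht)
    · exact (map_continuous H.toHomotopy.curry).subtype_mk _
    · ext t
      exact H.apply_zero t
    · ext t
      exact H.apply_one t

/-- A continuous map that reflects being joined to `c`, and is surjective on classes of loops at
`c`, lifts paths starting from `c` up to homotopy. -/
theorem exists_path_map_homotopic {P Q : Type*} [TopologicalSpace P] [TopologicalSpace Q]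
    {Φ : P → Q} (hΦ : Continuous Φ) {c a : P} (hinj : Joined (Φ c) (Φ a) → Joined c a)
    (hsurj : ∀ ω : Path (Φ c) (Φ c), ∃ ρ : Path c c, (ρ.map hΦ).Homotopic ω)
    (η : Path (Φ c) (Φ a)) : ∃ γ : Path c a, (γ.map hΦ).Homotopic η := by
  obtain ⟨γ⟩ := hinj ⟨η⟩
  obtain ⟨ρ, hρ⟩ := hsurj (η.trans (γ.map hΦ).symm)
  refine ⟨ρ.trans γ, ?_⟩
  rw [Path.map_trans]
  rw [← Path.Homotopic.Quotient.eq] at hρ ⊢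
  rw [Path.Homotopic.Quotient.mk_trans, hρ, Path.Homotopic.Quotient.mk_trans,
    Path.Homotopic.Quotient.mk_symm, Path.Homotopic.Quotient.trans_assoc,
    Path.Homotopic.Quotient.symm_trans, Path.Homotopic.Quotient.trans_refl]

theorem GenLoop.joined_of_joined_push {N X Y : Type} [TopologicalSpace X] [TopologicalSpace Y]
    (f : C(X, Y)) {x : X} {y : Y} (hf : f x = y) (H : Injective (HomotopyGroup.map N f hf))
    {p q : GenLoop N X x} (h : Joined (GenLoop.push f hf p) (GenLoop.push f hf q)) :
    Joined p q := by
  rw [GenLoop.joined_iff_homotopic] at h ⊢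
  have := @H (Quotient.mk _ p) (Quotient.mk _ q) (Quotient.sound h)
  exact Quotient.exact this

theorem GenLoop.exists_loop_push_homotopic {N X Y : Type} [DecidableEq N] [TopologicalSpace X]
    [TopologicalSpace Y] (i : N) (f : C(X, Y)) {x : X} {y : Y} (hf : f x = y)
    (H : Surjective (HomotopyGroup.map N f hf))
    (ω : Path (GenLoop.push f hf (GenLoop.const : GenLoop {j // j ≠ i} X x))
      (GenLoop.push f hf GenLoop.const)) :
    ∃ ρ : Path (GenLoop.const : GenLoop {j // j ≠ i} X x) GenLoop.const,
      (ρ.map (GenLoop.continuous_push f hf)).Homotopic ω := by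
  have hc := (GenLoop.push_const (N := {j // j ≠ i}) f hf).symm
  obtain ⟨p, hp⟩ := H (Quotient.mk _ (GenLoop.fromLoop i (ω.cast hc hc)))
  induction p using Quotient.inductionOn with | _ p
  have h1 : GenLoop.Homotopic (GenLoop.push f hf p) (GenLoop.fromLoop i (ω.cast hc hc)) :=
    Quotient.exact hp
  have h2 := GenLoop.homotopicTo i h1
  rw [GenLoop.to_from] at h2
  refine ⟨GenLoop.toLoop i p, ?_⟩
  obtain ⟨F⟩ := h2
  exact ⟨⟨⟨F.toContinuousMap, fun t => (F.apply_zero t).trans rfl,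
    fun t => (F.apply_one t).trans rfl⟩, fun t s hs => F.eq_fst t hs⟩⟩

/-- Bijectivity of the induced map on homotopy groups does not depend on the names of the
coordinates. -/
theorem HomotopyGroup.bijective_map_of_equiv {M N X Y : Type} [TopologicalSpace X]
    [TopologicalSpace Y] (e : M ≃ N) (f : C(X, Y)) {x : X} {y : Y} (hf : f x = y)
    (H : Bijective (HomotopyGroup.map M f hf)) : Bijective (HomotopyGroup.map N f hf) := by
  have key : ∀ {A : Type} [TopologicalSpace A] {a : A} {M N : Type} (e : M ≃ N)
      {p q : GenLoop M A a}, GenLoop.Homotopic p q →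
      GenLoop.Homotopic (GenLoop.congr a e p) (GenLoop.congr a e q) := by
    intro A _ a M N e p q h
    rw [← GenLoop.joined_iff_homotopic] at h ⊢
    exact h.map (GenLoop.congr a e).continuous
  have nat : ∀ (p : GenLoop M X x), GenLoop.congr y e (GenLoop.push f hf p) =
      GenLoop.push f hf (GenLoop.congr x e p) := fun p => rfl
  have nat' : ∀ (p : GenLoop N X x), GenLoop.congr y e.symm (GenLoop.push f hf p) =
      GenLoop.push f hf (GenLoop.congr x e.symm p) := fun p => rfl
  constructor
  · intro p q
    induction p using Quotient.inductionOn with | _ p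
    induction q using Quotient.inductionOn with | _ q
    intro h
    have h : GenLoop.Homotopic (GenLoop.push f hf p) (GenLoop.push f hf q) := Quotient.exact h
    have h1 := key e.symm h
    rw [nat', nat'] at h1
    have h2 := @H.1 (Quotient.mk _ _) (Quotient.mk _ _) (Quotient.sound h1)
    have h3 := key e (Quotient.exact h2)
    exact Quotient.sound (by simpa using ((GenLoop.congr x e).apply_symm_apply p) ▸
      ((GenLoop.congr x e).apply_symm_apply q) ▸ h3)
  · intro q
    induction q using Quotient.inductionOn with | _ q
    obtain ⟨p, hp⟩ := H.2 (Quotient.mk _ (GenLoop.congr y e.symm q))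
    induction p using Quotient.inductionOn with | _ p
    have h : GenLoop.Homotopic (GenLoop.push f hf p) (GenLoop.congr y e.symm q) :=
      Quotient.exact hp
    have h1 := key e h
    rw [nat] at h1
    refine ⟨Quotient.mk _ (GenLoop.congr x e p), Quotient.sound ?_⟩
    exact ((GenLoop.congr y e).apply_symm_apply q) ▸ h1

theorem HomotopyGroup.subsingleton_of_isEmpty {N X : Type} [IsEmpty N] [TopologicalSpace X]
    [PathConnectedSpace X] (x : X) : Subsingleton (HomotopyGroup N X x) := by
  constructor
  intro p q
  induction p using Quotient.inductionOn with | _ p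
  induction q using Quotient.inductionOn with | _ q
  refine Quotient.sound ?_
  obtain ⟨γ⟩ := PathConnectedSpace.joined (p isEmptyElim) (q isEmptyElim)
  refine ⟨⟨⟨⟨fun s => γ s.1, by fun_prop⟩, fun t => ?_, fun t => ?_⟩, fun s t ht => ?_⟩⟩
  · change γ 0 = p t
    rw [γ.source, Subsingleton.elim t isEmptyElim]
  · change γ 1 = q t
    rw [γ.target, Subsingleton.elim t isEmptyElim]
  · obtain ⟨i, -⟩ := ht
    exact isEmptyElim i

end GenLoop

section Cube

variable {N : Type}

/-- The affine identification of the cube `[-1, 1]^N` with the unit cube, as a retraction. -/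
noncomputable def toCube (w : N → ℝ) : N → I :=
  fun j => projIcc 0 1 zero_le_one ((w j + 1) / 2)

/-- The affine identification of the unit cube with `[-1, 1]^N`. -/
def ofCube (y : N → I) : N → ℝ := fun j => 2 * (y j : ℝ) - 1

theorem continuous_toCube : Continuous (toCube : (N → ℝ) → N → I) := by
  unfold toCube
  exact continuous_pi fun j => continuous_projIcc.comp (by fun_prop)

theorem continuous_ofCube : Continuous (ofCube : (N → I) → N → ℝ) := by
  unfold ofCube
  fun_prop

variable [Fintype N]

theorem ofCube_mem (y : N → I) : ofCube y ∈ closedBall (0 : N → ℝ) 1 := by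
  rw [mem_closedBall_zero_iff, pi_norm_le_iff_of_nonneg zero_le_one]
  intro j
  have h0 := (y j).2.1
  have h1 := (y j).2.2
  rw [Real.norm_eq_abs, abs_le]
  constructor <;> simp only [ofCube] <;> linarith

theorem ofCube_toCube {w : N → ℝ} (hw : w ∈ closedBall (0 : N → ℝ) 1) :
    ofCube (toCube w) = w := by
  rw [mem_closedBall_zero_iff, pi_norm_le_iff_of_nonneg zero_le_one] at hw
  ext j
  have := abs_le.1 (hw j)
  simp only [ofCube, toCube]
  rw [projIcc_of_mem zero_le_one (x := (w j + 1) / 2) ⟨by linarith [this.1], by linarith [this.2]⟩]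
  ring

theorem exists_abs_eq_one {w : N → ℝ} (hw : w ∈ sphere (0 : N → ℝ) 1) : ∃ j, |w j| = 1 := by
  rw [mem_sphere_zero_iff_norm] at hw
  have hne : Nonempty N := by
    by_contra h
    rw [not_nonempty_iff] at h
    rw [Subsingleton.elim w 0, norm_zero] at hw
    exact zero_ne_one hw
  obtain ⟨j, hj⟩ := (IsGreatest.pi_norm w).1
  exact ⟨j, by rw [← hw]; exact hj⟩

theorem ofCube_mem_sphere {y : N → I} (hy : y ∈ Cube.boundary N) :
    ofCube y ∈ sphere (0 : N → ℝ) 1 := by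
  obtain ⟨j, hj⟩ := hy
  have h := mem_closedBall_zero_iff.1 (ofCube_mem y)
  rw [mem_sphere_zero_iff_norm]
  refine le_antisymm h ?_
  refine le_trans ?_ (norm_le_pi_norm (ofCube y) j)
  rcases hj with hj | hj <;> simp only [ofCube, hj] <;> norm_num

theorem toCube_mem_boundary {w : N → ℝ} (hw : w ∈ sphere (0 : N → ℝ) 1) :
    toCube w ∈ Cube.boundary N := by
  obtain ⟨j, hj⟩ := exists_abs_eq_one hw
  refine ⟨j, ?_⟩
  rcases (abs_eq zero_le_one).1 hj with h | h
  · right; simp [toCube, h]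
  · left; simp [toCube, h]

/-- The homotopy extension and lifting property for maps that are constant off the top face of
the cube, in terms of paths of generalized loops. -/
theorem compressesAlong_of_const_off_top {Y Z : Type} [TopologicalSpace Y] [TopologicalSpace Z]
    (φ : C(Y, Z)) {y₀ : Y} {z₀ : Z} (hφ : φ y₀ = z₀)
    (hlift : ∀ (a : GenLoop N Y y₀) (η : Path (GenLoop.push φ hφ GenLoop.const)
      (GenLoop.push φ hφ a)), ∃ γ : Path GenLoop.const a,
        (γ.map (GenLoop.continuous_push φ hφ)).Homotopic η)
    {g : (N → ℝ) × ℝ → Y} {h : (N → ℝ) × ℝ → Z} (hg : ContinuousOn g (sphere 0 1))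
    (hh : ContinuousOn h (closedBall 0 1))
    (hc : ∀ x ∈ sphere (0 : (N → ℝ) × ℝ) 1, h x = φ (g x))
    (hgb : ∀ w ∈ closedBall (0 : N → ℝ) 1, g (w, -1) = y₀)
    (hgs : ∀ w ∈ sphere (0 : N → ℝ) 1, ∀ t ∈ Icc (-1 : ℝ) 1, g (w, t) = y₀) :
    CompressesAlong φ g h := by
  have mt : ∀ w ∈ closedBall (0 : N → ℝ) 1, ((w, 1) : (N → ℝ) × ℝ) ∈ sphere (0 : (N → ℝ) × ℝ) 1 :=
    fun w hw => mem_sphere_prod_real.2 (Or.inr ⟨hw, by simp⟩)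
  have mb : ∀ w ∈ closedBall (0 : N → ℝ) 1, ((w, -1) : (N → ℝ) × ℝ) ∈ sphere (0 : (N → ℝ) × ℝ) 1 :=
    fun w hw => mem_sphere_prod_real.2 (Or.inr ⟨hw, by simp⟩)
  have o : (1 : ℝ) ∈ Icc (-1 : ℝ) 1 := by simp
  let a : GenLoop N Y y₀ := ⟨⟨fun y => g (ofCube y, 1),
      hg.comp_continuous (by have := continuous_ofCube (N := N); fun_prop)
        fun y => mt _ (ofCube_mem y)⟩,
    fun y hy => hgs _ (ofCube_mem_sphere hy) 1 o⟩
  have hI : ∀ t : I, 2 * (t : ℝ) - 1 ∈ Icc (-1 : ℝ) 1 := fun t =>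
    ⟨by linarith [t.2.1], by linarith [t.2.2]⟩
  let ηf : C(I × (N → I), Z) := ⟨fun q => h (ofCube q.2, 2 * (q.1 : ℝ) - 1),
    hh.comp_continuous (by have := continuous_ofCube (N := N); fun_prop)
      fun q => mem_closedBall_prod_real.2 ⟨ofCube_mem _, hI _⟩⟩
  let η : Path (GenLoop.push φ hφ GenLoop.const) (GenLoop.push φ hφ a) :=
    { toFun := fun t => ⟨ηf.curry t, fun y hy => by
        change h (ofCube y, 2 * (t : ℝ) - 1) = z₀
        rw [hc _ (mem_sphere_prod_real.2 (Or.inl ⟨ofCube_mem_sphere hy, hI t⟩)),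
          hgs _ (ofCube_mem_sphere hy) _ (hI t), hφ]⟩
      continuous_toFun := (map_continuous ηf.curry).subtype_mk _
      source' := by
        ext y
        change h (ofCube y, 2 * ((0 : I) : ℝ) - 1) = φ y₀
        rw [← hgb _ (ofCube_mem y), ← hc _ (mb _ (ofCube_mem y))]
        norm_num
      target' := by
        ext y
        change h (ofCube y, 2 * ((1 : I) : ℝ) - 1) = φ (g (ofCube y, 1))
        rw [← hc _ (mt _ (ofCube_mem y))]
        norm_num }
  have hη : ∀ t y, η t y = h (ofCube y, 2 * (t : ℝ) - 1) := fun _ _ => rfl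
  obtain ⟨γ, ⟨P⟩⟩ := hlift a η
  let toI : ℝ → I := fun t => projIcc 0 1 zero_le_one ((t + 1) / 2)
  have htoI : Continuous toI := continuous_projIcc.comp (by fun_prop)
  have htoI1 : toI 1 = 1 := by simp [toI]
  have htoI0 : toI (-1) = 0 := by simp [toI]
  have htoI2 : ∀ t ∈ Icc (-1 : ℝ) 1, 2 * (toI t : ℝ) - 1 = t := by
    intro t ht
    simp only [toI]
    rw [projIcc_of_mem zero_le_one (x := (t + 1) / 2) ⟨by linarith [ht.1], by linarith [ht.2]⟩]
    ring
  have cC := continuous_toCube (N := N)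
  have hηh : ∀ x ∈ closedBall (0 : (N → ℝ) × ℝ) 1, η (toI x.2) (toCube x.1) = h x := by
    rintro ⟨w, t⟩ hx
    obtain ⟨hw, ht⟩ := mem_closedBall_prod_real.1 hx
    rw [hη, ofCube_toCube hw, htoI2 t ht]
  refine ⟨fun x => γ (toI x.2) (toCube x.1),
    fun q => P (symm (toI q.2), toI q.1.2) (toCube q.1.1), ?_, ?_, ?_, ?_, ?_, ?_⟩
  · exact (ContinuousEval.continuous_eval.comp ((γ.continuous.comp
      (htoI.comp continuous_snd)).prodMk (cC.comp continuous_fst))).continuousOn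
  · refine (ContinuousEval.continuous_eval.comp (((map_continuous P).comp ?_).prodMk
      ?_)).continuousOn <;> fun_prop
  · rintro ⟨w, t⟩ hx
    rcases mem_sphere_prod_real.1 hx with ⟨hw, ht⟩ | ⟨hw, rfl | rfl⟩
    · rw [hgs w hw t ht]
      exact (γ _).2 _ (toCube_mem_boundary hw)
    · change γ (toI (-1)) _ = _
      rw [htoI0, γ.source, hgb w hw]
      rfl
    · change γ (toI 1) _ = _
      rw [htoI1, γ.target]
      change g (ofCube (toCube w), 1) = _
      rw [ofCube_toCube hw]
  · intro x hx
    change P (symm (toI (-1)), toI x.2) (toCube x.1) = _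
    rw [htoI0, unitInterval.symm_zero, P.apply_one]
    exact hηh x hx
  · intro x hx
    change P (symm (toI 1), toI x.2) (toCube x.1) = _
    rw [htoI1, unitInterval.symm_one, P.apply_zero]
    rfl
  · rintro ⟨w, t⟩ hx r hr
    have hb := hηh (w, t) (sphere_subset_closedBall hx)
    rcases mem_sphere_prod_real.1 hx with ⟨hw, ht⟩ | ⟨hw, rfl | rfl⟩
    · have e1 : P (symm (toI r), toI t) (toCube w) = z₀ :=
        (P (symm (toI r), toI t)).2 _ (toCube_mem_boundary hw)
      have e2 : η (toI t) (toCube w) = z₀ := (η (toI t)).2 _ (toCube_mem_boundary hw)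
      exact e1.trans (e2.symm.trans hb)
    · change P (symm (toI r), toI (-1)) (toCube w) = _
      rw [← hb]
      simp only [htoI0]
      rw [P.eq_fst _ (by simp)]
      simp
    · change P (symm (toI r), toI 1) (toCube w) = _
      rw [← hb]
      simp only [htoI1]
      rw [P.eq_fst _ (by simp)]
      simp

end Cube

section HELPFin

variable {Y Z : Type} [TopologicalSpace Y] [TopologicalSpace Z]

theorem norm_funSplitAt {N : Type} [Fintype N] [DecidableEq N] (i : N) (x : N → ℝ) :
    ‖(Homeomorph.funSplitAt ℝ i x).swap‖ = ‖x‖ := by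
  refine le_antisymm ?_ ?_
  · refine max_le ?_ (norm_le_pi_norm x i)
    exact (pi_norm_le_iff_of_nonneg (norm_nonneg _)).2 fun j => norm_le_pi_norm x j
  · refine (pi_norm_le_iff_of_nonneg (norm_nonneg _)).2 fun j => ?_
    by_cases h : j = i
    · subst h
      exact le_max_right _ _
    · exact (norm_le_pi_norm (fun k : {k // k ≠ i} => x k) ⟨j, h⟩).trans (le_max_left _ _)

/-- A map inducing bijections on all homotopy groups has the homotopy extension and lifting
property for the pairs (ball, sphere). -/
theorem hasHELP_of_bijective [PathConnectedSpace Y] [PathConnectedSpace Z]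
    (φ : C(Y, Z)) {y₀ : Y} {z₀ : Z} (hφ : φ y₀ = z₀)
    (H : ∀ n, Bijective (HomotopyGroup.map (Fin n) φ hφ)) (n : ℕ) : HasHELP (Fin n → ℝ) φ := by
  rcases n with _ | n
  · intro g h hg hh hc
    have hs : ∀ x : Fin 0 → ℝ, x ∉ sphere (0 : Fin 0 → ℝ) 1 := fun x hx => by
      rw [mem_sphere_zero_iff_norm, Subsingleton.elim x 0, norm_zero] at hx
      exact zero_ne_one hx
    let P : Path (h 0) (φ y₀) := PathConnectedSpace.somePath _ _
    refine ⟨fun _ => y₀, fun q => P.extend ((q.2 + 1) / 2), continuousOn_const,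
      (P.continuous_extend.comp (by fun_prop)).continuousOn, fun x hx => (hs x hx).elim,
      fun x _ => ?_, fun x _ => ?_, fun x hx => (hs x hx).elim⟩
    · rw [Subsingleton.elim x 0]
      simp
    · simp
  · have e : Fin n ≃ {j : Fin (n + 1) // j ≠ 0} := finSuccAboveEquiv 0
    have H' : Bijective (HomotopyGroup.map {j : Fin (n + 1) // j ≠ 0} φ hφ) :=
      HomotopyGroup.bijective_map_of_equiv e φ hφ (H n)
    let N := {j : Fin (n + 1) // j ≠ 0}
    have key : HasHELP ((N → ℝ) × ℝ) φ := by
      intro g h hg hh hc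
      obtain ⟨γ, hγ, hγ0, hγb, hγs⟩ := exists_homotopy_const_off_top y₀ hg
      refine (CompressesAlong.of_homotopy hγ hh (fun x hx => by rw [hγ0 x hx, hc x hx])
        fun h' hh' hc' => ?_).congr hγ0
      refine compressesAlong_of_const_off_top φ hφ (fun a η => ?_)
        (hγ.comp (by fun_prop) fun x hx => ⟨hx, by simp⟩) hh' hc' hγb hγs
      exact exists_path_map_homotopic _
        (fun hj => GenLoop.joined_of_joined_push φ hφ H'.1 hj)
        (fun ω => GenLoop.exists_loop_push_homotopic 0 φ hφ (H (n + 1)).2 ω) η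
    refine key.of_homeomorph (((Homeomorph.funSplitAt ℝ 0).trans
      (Homeomorph.prodComm _ _)).symm) fun x => ?_
    obtain ⟨y, rfl⟩ := ((Homeomorph.funSplitAt ℝ (0 : Fin (n + 1))).trans
      (Homeomorph.prodComm _ _)).surjective x
    rw [Homeomorph.symm_apply_apply]
    exact (norm_funSplitAt 0 y).symm

end HELPFin

section MappingPathSpace

variable {Y Z : Type*} [TopologicalSpace Y] [TopologicalSpace Z]

/-- The right lifting property of `p` against the inclusion of the sphere in the ball of `V`. -/
def HasBallLifting (V : Type*) [NormedAddCommGroup V] [NormedSpace ℝ V] (p : Y → Z) : Prop :=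
  ∀ (e : V → Y) (h : V → Z), ContinuousOn e (sphere 0 1) → ContinuousOn h (closedBall 0 1) →
    (∀ x ∈ sphere (0 : V) 1, p (e x) = h x) →
    ∃ l : V → Y, ContinuousOn l (closedBall 0 1) ∧ (∀ x ∈ sphere (0 : V) 1, l x = e x) ∧
      ∀ x ∈ closedBall (0 : V) 1, p (l x) = h x

/-- The mapping path space of `φ`, consisting of the pairs of a point `y` of `Y` and a path in `Z`
ending at `φ y`. -/
def MappingPathSpace (φ : C(Y, Z)) : Type _ :=
  {e : Y × C(I, Z) // e.2 1 = φ e.1}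

instance (φ : C(Y, Z)) : TopologicalSpace (MappingPathSpace φ) :=
  inferInstanceAs (TopologicalSpace {e : Y × C(I, Z) // e.2 1 = φ e.1})

namespace MappingPathSpace

/-- The endpoint projection of the mapping path space to the source. -/
def fst {φ : C(Y, Z)} : C(MappingPathSpace φ, Y) :=
  ⟨fun e => e.1.1, continuous_fst.comp continuous_subtype_val⟩

/-- The path underlying a point of the mapping path space. -/
def path {φ : C(Y, Z)} : C(MappingPathSpace φ, C(I, Z)) :=
  ⟨fun e => e.1.2, continuous_snd.comp continuous_subtype_val⟩

theorem path_one {φ : C(Y, Z)} (e : MappingPathSpace φ) : path e 1 = φ (fst e) := e.2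

/-- The starting point of the path underlying a point of the mapping path space. -/
def proj {φ : C(Y, Z)} : C(MappingPathSpace φ, Z) :=
  ⟨fun e => path e 0, (continuous_eval_const (0 : I)).comp (map_continuous path)⟩

end MappingPathSpace

open MappingPathSpace in
theorem HasHELP.hasBallLifting {V : Type*} [NormedAddCommGroup V] [NormedSpace ℝ V] {φ : C(Y, Z)}
    (H : HasHELP V φ) : HasBallLifting V (proj (φ := φ)) := by
  intro e h he hh hc
  let toI : ℝ → I := projIcc 0 1 zero_le_one
  have htoI : Continuous toI := continuous_projIcc
  obtain ⟨K, hK, hK0, hKs⟩ := exists_homotopy_extension (H := fun q => path (e q.1) (toI q.2)) hh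
    (ContinuousEval.continuous_eval.comp_continuousOn
      (((map_continuous path).comp_continuousOn (he.comp continuousOn_fst fun q hq => hq.1)).prodMk
        (htoI.comp continuous_snd).continuousOn))
    (fun x hx => by
      have h0 : toI 0 = 0 := by simp [toI]
      simp only [h0]
      exact hc x hx)
  have z : (0 : ℝ) ∈ Icc (0 : ℝ) 1 := by simp
  have o : (1 : ℝ) ∈ Icc (0 : ℝ) 1 := by simp
  have hK1 : ∀ x ∈ sphere (0 : V) 1, K (x, 1) = φ (fst (e x)) := fun x hx => by
    rw [hKs x hx 1 o, ← path_one]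
    simp [toI]
  obtain ⟨G, L, hG, hL, hGs, hLb, hLt, hLs⟩ := H (fun x => fst (e x)) (fun x => K (x, 1))
    ((map_continuous fst).comp_continuousOn he) (hK.comp (by fun_prop) fun x hx => ⟨hx, o⟩) hK1
  obtain ⟨L', hL', hL'b, hL't, hL's⟩ := exists_prism_filling (bot := K)
    (top := fun q => φ (G q.1)) (side := fun q => K (q.1.1, max ((q.1.2 + 1) / 2) q.2)) hK
    (φ.continuous.comp_continuousOn (hG.comp continuousOn_fst fun q hq => hq.1))
    (hK.comp (by fun_prop) (by
      rintro ⟨⟨x, t⟩, s⟩ ⟨⟨hx, ht⟩, hs⟩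
      exact ⟨sphere_subset_closedBall hx, le_max_of_le_right hs.1,
        max_le (by change (t + 1) / 2 ≤ 1; linarith [ht.2]) hs.2⟩))
    (fun x hx s hs => by simp [hs.1])
    (fun x hx s hs => by
      have : max ((1 + 1) / 2) s = 1 := by rw [max_eq_left] <;> norm_num [hs.2]
      simp only [this]
      rw [hK1 x hx, hGs x hx])
    hL hLb hLt (fun x hx t ht => by
      rw [hLs x hx t ht, max_eq_right (by linarith [ht.2])])
  have hL's' : ∀ x ∈ sphere (0 : V) 1, ∀ s : I, L' (x, 2 * (s : ℝ) - 1) = path (e x) s := by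
    intro x hx s
    rw [hL's x hx _ ⟨by linarith [s.2.1], by linarith [s.2.2]⟩]
    have : max ((2 * (s : ℝ) - 1 + 1) / 2) 0 = s := by
      rw [max_eq_left] <;> linarith [s.2.1]
    simp only [this]
    rw [hKs x hx _ s.2]
    simp [toI]
  let r : V → V := fun x => (max 1 ‖x‖)⁻¹ • x
  have hr : Continuous r :=
    Continuous.smul (Continuous.inv₀ (by fun_prop) fun x => by positivity) continuous_id
  have hrm : ∀ x, r x ∈ closedBall (0 : V) 1 := fun x => by
    have hp : 0 < max 1 ‖x‖ := by positivity
    rw [mem_closedBall_zero_iff, norm_smul, norm_inv, Real.norm_of_nonneg hp.le,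
      inv_mul_le_iff₀ hp]
    simp
  have hrx : ∀ x ∈ closedBall (0 : V) 1, r x = x := fun x hx => by
    simp only [r]
    rw [max_eq_left (by simpa using hx)]
    simp
  let c : C(V × I, Z) := ⟨fun q => L' (r q.1, 2 * (q.2 : ℝ) - 1), hL'.comp_continuous
    (by fun_prop) fun q => mem_closedBall_prod_real.2
      ⟨hrm _, by linarith [q.2.2.1], by linarith [q.2.2.2]⟩⟩
  refine ⟨fun x => ⟨(G (r x), c.curry x), ?_⟩, ?_, ?_, ?_⟩
  · change L' (r x, 2 * ((1 : I) : ℝ) - 1) = φ (G (r x))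
    rw [← hL't _ (hrm x)]
    norm_num
  · exact (Continuous.subtype_mk ((hG.comp_continuous hr hrm).prodMk
      (map_continuous c.curry)) _).continuousOn
  · intro x hx
    refine Subtype.ext (Prod.ext ?_ (ContinuousMap.ext fun s => ?_))
    · change G (r x) = fst (e x)
      rw [hrx x (sphere_subset_closedBall hx), hGs x hx]
    · change L' (r x, _) = path (e x) s
      rw [hrx x (sphere_subset_closedBall hx), hL's' x hx]
  · intro x hx
    change L' (r x, 2 * ((0 : I) : ℝ) - 1) = h x
    rw [hrx x hx, ← hK0 x hx, ← hL'b x hx]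
    norm_num

end MappingPathSpace

section CellularLifting

theorem IsCompact.continuousOn_image {D X Y : Type*} [TopologicalSpace D] [TopologicalSpace X]
    [TopologicalSpace Y] [T2Space X] {K : Set D} (hK : IsCompact K) {Φ : D → X}
    (hΦ : ContinuousOn Φ K) {F : X → Y} (hF : ContinuousOn (F ∘ Φ) K) :
    ContinuousOn F (Φ '' K) := by
  rw [continuousOn_iff_isClosed]
  intro t ht
  obtain ⟨u, hu, hu'⟩ := continuousOn_iff_isClosed.1 hF t ht
  refine ⟨Φ '' (u ∩ K), ?_, ?_⟩
  · exact ((hK.inter_left hu).image_of_continuousOn (hΦ.mono inter_subset_right)).isClosed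
  · rw [← hu']
    ext x
    constructor
    · rintro ⟨hx, y, hy, rfl⟩
      exact ⟨⟨y, ⟨hx, hy⟩, rfl⟩, y, hy, rfl⟩
    · rintro ⟨⟨y, ⟨hx, hy⟩, rfl⟩, h⟩
      exact ⟨hx, h⟩

namespace CWStructure

variable {X : Type} [TopologicalSpace X] (S : CWStructure X)

theorem exists_mem_openCell_of_mem_closedCell {n : ℕ} {i : S.cell n} {x : X}
    (hx : x ∈ S.map n i '' closedBall 0 1) : ∃ m ≤ n, ∃ j, x ∈ S.map m j '' ball 0 1 := by
  induction n using Nat.strong_induction_on generalizing x with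
  | _ n ih =>
    obtain ⟨y, hy, rfl⟩ := hx
    rw [← ball_union_sphere] at hy
    rcases hy with hy | hy
    · exact ⟨n, le_rfl, i, y, hy, rfl⟩
    · obtain ⟨J, hJ⟩ := S.mapsTo n i
      have := hJ hy
      simp only [mem_iUnion] at this
      obtain ⟨m, hm, j, hj, h⟩ := this
      obtain ⟨k, hk, l, hl⟩ := ih m hm h
      exact ⟨k, hk.trans hm.le, l, hl⟩

theorem openCell_index_eq {m n : ℕ} {i : S.cell m} {j : S.cell n} {x : X}
    (hi : x ∈ S.map m i '' ball 0 1) (hj : x ∈ S.map n j '' ball 0 1) :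
    (⟨m, i⟩ : Σ n, S.cell n) = ⟨n, j⟩ := by
  by_contra h
  exact (S.pairwiseDisjoint (mem_univ ⟨m, i⟩) (mem_univ ⟨n, j⟩) h).le_bot ⟨hi, hj⟩

theorem notMem_openCell_of_mem_closedCell {m n : ℕ} (hmn : m < n) {i : S.cell m} {x : X}
    (hx : x ∈ S.map m i '' closedBall 0 1) (j : S.cell n) : x ∉ S.map n j '' ball 0 1 := by
  intro h
  obtain ⟨k, hk, l, hl⟩ := S.exists_mem_openCell_of_mem_closedCell hx
  have := congrArg Sigma.fst (S.openCell_index_eq h hl)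
  simp only at this
  lia

theorem symm_map_apply {n : ℕ} {i : S.cell n} {y : Fin n → ℝ} (hy : y ∈ ball 0 1) :
    (S.map n i).symm (S.map n i y) = y :=
  (S.map n i).left_inv (by rwa [S.source_eq])

theorem isCompact_closedCell (n : ℕ) (i : S.cell n) :
    IsCompact (S.map n i '' closedBall 0 1) :=
  (isCompact_closedBall 0 1).image_of_continuousOn (S.continuousOn n i)

theorem continuous_of_continuousOn [T2Space X] {Y : Type*} [TopologicalSpace Y] {f : X → Y}
    (hf : ∀ n i, ContinuousOn f (S.map n i '' closedBall 0 1)) : Continuous f := by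
  rw [continuous_iff_isClosed]
  intro t ht
  refine S.closed' _ fun n i => ?_
  rw [inter_comm]
  exact (hf n i).preimage_isClosed_of_isClosed (S.isCompact_closedCell n i).isClosed ht

/-- Extension of a partial lift over the cells of dimension `n`. -/
theorem exists_lift_succ [T2Space X] {E Z : Type*} [TopologicalSpace E] [TopologicalSpace Z]
    {p : E → Z} {h : X → Z} (hh : Continuous h) {n : ℕ} (hp : HasBallLifting (Fin n → ℝ) p)
    {f : X → E} (hf : ∀ m < n, ∀ i : S.cell m, ContinuousOn f (S.map m i '' closedBall 0 1) ∧
      ∀ x ∈ S.map m i '' closedBall 0 1, p (f x) = h x) :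
    ∃ f' : X → E, (∀ m < n + 1, ∀ i : S.cell m,
      ContinuousOn f' (S.map m i '' closedBall 0 1) ∧
        ∀ x ∈ S.map m i '' closedBall 0 1, p (f' x) = h x) ∧
      ∀ m < n, ∀ i : S.cell m, EqOn f' f (S.map m i '' closedBall 0 1) := by
  classical
  have hl : ∀ i : S.cell n, ∃ l : (Fin n → ℝ) → E, ContinuousOn l (closedBall 0 1) ∧
      (∀ x ∈ sphere (0 : Fin n → ℝ) 1, l x = f (S.map n i x)) ∧
      ∀ x ∈ closedBall (0 : Fin n → ℝ) 1, p (l x) = h (S.map n i x) := by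
    intro i
    obtain ⟨J, hJ⟩ := S.mapsTo n i
    refine hp _ _ ?_ (hh.comp_continuousOn (S.continuousOn n i)) ?_
    · have hU : ContinuousOn f (⋃ q : Σ m : Fin n, J m, S.map q.1 q.2 '' closedBall 0 1) :=
        (locallyFinite_of_finite _).continuousOn_iUnion
          (fun q => (S.isCompact_closedCell _ _).isClosed) (fun q => (hf q.1 q.1.2 q.2).1)
      refine hU.comp ((S.continuousOn n i).mono sphere_subset_closedBall) fun y hy => ?_
      have := hJ hy
      simp only [mem_iUnion] at this ⊢
      obtain ⟨m, hm, j, hj, h⟩ := this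
      exact ⟨⟨⟨m, hm⟩, ⟨j, hj⟩⟩, h⟩
    · intro y hy
      have := hJ hy
      simp only [mem_iUnion] at this
      obtain ⟨m, hm, j, hj, h⟩ := this
      exact (hf m hm j).2 _ h
  choose l hl hls hlp using hl
  let f' : X → E := fun x => if hx : ∃ i : S.cell n, x ∈ S.map n i '' ball 0 1 then
    l hx.choose ((S.map n hx.choose).symm x) else f x
  have hlow : ∀ m < n, ∀ i : S.cell m, EqOn f' f (S.map m i '' closedBall 0 1) := by
    intro m hm i x hx
    have : ¬ ∃ i : S.cell n, x ∈ S.map n i '' ball 0 1 := fun ⟨j, hj⟩ =>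
      S.notMem_openCell_of_mem_closedCell hm hx j hj
    simp only [f', dif_neg this]
  have htop : ∀ (i : S.cell n), ∀ y ∈ closedBall (0 : Fin n → ℝ) 1,
      f' (S.map n i y) = l i y := by
    intro i y hy
    rw [← ball_union_sphere] at hy
    rcases hy with hy | hy
    · have hx : ∃ j : S.cell n, S.map n i y ∈ S.map n j '' ball 0 1 := ⟨i, y, hy, rfl⟩
      have hi : hx.choose = i := by
        have := S.openCell_index_eq hx.choose_spec ⟨y, hy, rfl⟩
        simpa using this
      simp only [f', dif_pos hx]
      rw [hi, S.symm_map_apply hy]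
    · rw [hls i y hy]
      obtain ⟨J, hJ⟩ := S.mapsTo n i
      have := hJ hy
      simp only [mem_iUnion] at this
      obtain ⟨m, hm, j, hj, h⟩ := this
      exact hlow m hm j h
  refine ⟨f', fun m hm i => ?_, hlow⟩
  rcases (Nat.lt_succ_iff.1 hm).lt_or_eq with hm | rfl
  · refine ⟨(hf m hm i).1.congr (hlow m hm i), fun x hx => ?_⟩
    rw [hlow m hm i hx, (hf m hm i).2 x hx]
  · refine ⟨(isCompact_closedBall 0 1).continuousOn_image (S.continuousOn m i)
      ((hl i).congr (htop i)), ?_⟩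
    rintro _ ⟨y, hy, rfl⟩
    rw [htop i y hy, hlp i y hy]

/-- A map with the right lifting property against the inclusions of spheres in balls has the
lifting property for CW complexes, relative to a `0`-cell. -/
theorem exists_lift [T2Space X] {E Z : Type*} [TopologicalSpace E] [TopologicalSpace Z]
    {p : E → Z} (hp : ∀ n, HasBallLifting (Fin n → ℝ) p) (h : C(X, Z)) {x₀ : X}
    (hx₀ : S.IsZeroCell x₀) {e₀ : E} (he₀ : p e₀ = h x₀) :
    ∃ s : C(X, E), (∀ x, p (s x) = h x) ∧ s x₀ = e₀ := by
  classical
  have hsurj : ∀ z, ∃ e, p e = z := by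
    intro z
    obtain ⟨l, -, -, hl⟩ := hp 0 (fun _ => e₀) (fun _ => z) continuousOn_const continuousOn_const
      (fun x hx => by
        rw [mem_sphere_zero_iff_norm, Subsingleton.elim x 0, norm_zero] at hx
        exact (zero_ne_one hx).elim)
    exact ⟨l 0, hl 0 (by simp)⟩
  choose q hq using hsurj
  let P : ℕ → (X → E) → Prop := fun n f => ∀ m < n + 1, ∀ i : S.cell m,
    ContinuousOn f (S.map m i '' closedBall 0 1) ∧ ∀ x ∈ S.map m i '' closedBall 0 1, p (f x) = h x
  let f₁ : X → E := fun x => if x = x₀ then e₀ else q (h x)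
  have hf₁ : P 0 f₁ := by
    intro m hm i
    obtain rfl : m = 0 := by lia
    refine ⟨?_, fun x _ => ?_⟩
    · rintro _ ⟨y, hy, rfl⟩
      have : S.map 0 i '' closedBall 0 1 ⊆ {S.map 0 i y} := by
        rintro _ ⟨w, -, rfl⟩
        rw [Subsingleton.elim w y]
        rfl
      exact (continuousOn_singleton f₁ _).mono this _ ⟨y, hy, rfl⟩
    · simp only [f₁]
      split_ifs with hx
      · rw [he₀, hx]
      · exact hq _
  choose! next hnext hagree using fun (n : ℕ) (f : X → E) (hf : P n f) =>
    S.exists_lift_succ h.continuous (hp (n + 1)) hf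
  let F : ℕ → X → E := fun n => Nat.rec f₁ next n
  have hF : ∀ n, P n (F n) := by
    intro n
    induction n with
    | zero => exact hf₁
    | succ n ih => exact hnext n _ ih
  have hFF : ∀ n m, ∀ i : S.cell n, EqOn (F (n + m)) (F n) (S.map n i '' closedBall 0 1) := by
    intro n m i
    induction m with
    | zero => exact fun _ _ => rfl
    | succ m ih => exact (hagree (n + m) _ (hF _) n (by lia) i).trans ih
  have hex : ∀ x, ∃ n, ∃ i : S.cell n, x ∈ S.map n i '' closedBall 0 1 := by
    intro x
    have : x ∈ ⋃ (n : ℕ), ⋃ (i : S.cell n), S.map n i '' closedBall 0 1 := by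
      rw [S.union']; trivial
    simpa only [mem_iUnion] using this
  choose d c hc using hex
  let s : X → E := fun x => F (d x) x
  have hs : ∀ n (i : S.cell n), EqOn s (F n) (S.map n i '' closedBall 0 1) := by
    intro n i x hx
    simp only [s]
    rw [← hFF (d x) n (c x) (hc x), ← hFF n (d x) i hx, add_comm]
  refine ⟨⟨s, S.continuous_of_continuousOn fun n i =>
    ((hF n n (by lia) i).1).congr (hs n i)⟩, fun x => ?_, ?_⟩
  · exact (hF (d x) (d x) (by lia) (c x)).2 x (hc x)
  · obtain ⟨i, hi⟩ := hx₀
    change s x₀ = e₀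
    rw [hs 0 i ⟨0, by simp, hi⟩]
    simp [F, f₁]

end CWStructure

end CellularLifting

section Whitehead

theorem HomotopyGroup.map_map {N X Y Z : Type} [TopologicalSpace X] [TopologicalSpace Y]
    [TopologicalSpace Z] (f : C(X, Y)) (g : C(Y, Z)) {x : X} {y : Y} {z : Z} (hf : f x = y)
    (hg : g y = z) (hgf : (g.comp f) x = z) (p : HomotopyGroup N X x) :
    HomotopyGroup.map N g hg (HomotopyGroup.map N f hf p) =
      HomotopyGroup.map N (g.comp f) hgf p := by
  induction p using Quotient.inductionOn with | _ p
  rfl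

theorem HomotopyGroup.map_eq_of_homotopicRel {N X Y : Type} [TopologicalSpace X]
    [TopologicalSpace Y] {f g : C(X, Y)} {x : X} {y : Y} (hf : f x = y) (hg : g x = y)
    (h : f.HomotopicRel g {x}) : HomotopyGroup.map N f hf = HomotopyGroup.map N g hg := by
  funext p
  induction p using Quotient.inductionOn with | _ p
  obtain ⟨F⟩ := h
  refine Quotient.sound ⟨⟨⟨⟨fun s => F (s.1, p s.2), by fun_prop⟩, fun t => ?_, fun t => ?_⟩,
    fun s t ht => ?_⟩⟩
  · exact F.apply_zero _
  · exact F.apply_one _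
  · exact F.eq_fst s (p.2 t ht)

theorem HomotopyGroup.map_id {N X : Type} [TopologicalSpace X] {x : X}
    (h : ContinuousMap.id X x = x) : HomotopyGroup.map N (ContinuousMap.id X) h = id := by
  funext p
  induction p using Quotient.inductionOn with | _ p
  rfl

namespace CWStructure

variable {X Y : Type} [TopologicalSpace X] [TopologicalSpace Y] [T2Space X]
  [PathConnectedSpace X] [PathConnectedSpace Y]

open MappingPathSpace in
/-- A weak homotopy equivalence to a CW complex has a right inverse up to pointed homotopy. -/
theorem exists_homotopicRel_comp_id (S : CWStructure X) {x₀ : X} (hx₀ : S.IsZeroCell x₀) {y₀ : Y}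
    (φ : C(Y, X)) (hφ : φ y₀ = x₀) (H : ∀ n, Bijective (HomotopyGroup.map (Fin n) φ hφ)) :
    ∃ ψ : C(X, Y), ψ x₀ = y₀ ∧ (φ.comp ψ).HomotopicRel (ContinuousMap.id X) {x₀} := by
  obtain ⟨s, hs, hs₀⟩ := S.exists_lift (fun n => (hasHELP_of_bijective φ hφ H n).hasBallLifting)
    (ContinuousMap.id X) hx₀ (e₀ := ⟨(y₀, ContinuousMap.const I x₀), hφ.symm⟩) rfl
  refine ⟨fst.comp s, ?_,
    .symm ⟨⟨⟨⟨fun q => path (s q.2) q.1, ?_⟩, hs, fun x => path_one (s x)⟩, ?_⟩⟩⟩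
  · change fst (s x₀) = y₀
    rw [hs₀]
    rfl
  · exact ContinuousEval.continuous_eval.comp
      (((map_continuous path).comp ((map_continuous s).comp continuous_snd)).prodMk continuous_fst)
  · rintro t x rfl
    change path (s x) t = x
    rw [hs₀]
    rfl

/-- **Whitehead's theorem** for pointed self-maps of a CW complex. -/
theorem exists_homotopy_inverse (S : CWStructure X) {x₀ : X} (hx₀ : S.IsZeroCell x₀)
    (φ : C(X, X)) (hφ : φ x₀ = x₀) (H : ∀ n, Bijective (HomotopyGroup.map (Fin n) φ hφ)) :
    ∃ ψ : C(X, X), (ψ.comp φ).Homotopic (ContinuousMap.id X) ∧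
      (φ.comp ψ).Homotopic (ContinuousMap.id X) := by
  obtain ⟨ψ, hψ, hφψ⟩ := S.exists_homotopicRel_comp_id hx₀ φ hφ H
  have hcomp : (φ.comp ψ) x₀ = x₀ := by simp [hψ, hφ]
  have H' : ∀ n, Bijective (HomotopyGroup.map (Fin n) ψ hψ) := by
    intro n
    have h : HomotopyGroup.map (Fin n) φ hφ ∘ HomotopyGroup.map (Fin n) ψ hψ = id := by
      rw [← HomotopyGroup.map_id (N := Fin n) (x := x₀) rfl,
        ← HomotopyGroup.map_eq_of_homotopicRel hcomp rfl hφψ]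
      exact funext fun p => HomotopyGroup.map_map _ _ _ _ _ p
    exact (Bijective.of_comp_iff' (H n) _).1 (h ▸ bijective_id)
  obtain ⟨χ, -, hψχ⟩ := S.exists_homotopicRel_comp_id hx₀ ψ hψ H'
  replace hφψ := hφψ.homotopic
  replace hψχ := hψχ.homotopic
  have hφχ : φ.Homotopic χ :=
    (((ContinuousMap.Homotopic.refl φ).comp hψχ).symm : φ.Homotopic _).trans
      (hφψ.comp (.refl χ))
  exact ⟨ψ, ((ContinuousMap.Homotopic.refl ψ).comp hφχ).trans hψχ, hφψ⟩

end CWStructure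

end Whitehead

section CellPush

/-- A map from a Euclidean space into a space containing an open cell of higher dimension is
homotopic, by a homotopy supported over the cell, to a map missing a point of the cell. -/
theorem exists_homotopy_notMem_range {E V X : Type} [NormedAddCommGroup E] [NormedSpace ℝ E]
    [FiniteDimensional ℝ E] [NormedAddCommGroup V] [NormedSpace ℝ V] [FiniteDimensional ℝ V]
    [TietzeExtension.{0} V] (hEV : Module.finrank ℝ E < Module.finrank ℝ V)
    [TopologicalSpace X] {Φ : V → X} {Ψ : X → V} (hΦ : ContinuousOn Φ (ball 0 1))
    (hΨ : ContinuousOn Ψ (Φ '' ball 0 1)) (hΨΦ : ∀ y ∈ ball (0 : V) 1, Ψ (Φ y) = y) {α : E → X}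
    (hα : Continuous α) (hU : IsOpen (α ⁻¹' (Φ '' ball 0 1)))
    (hA : IsClosed (α ⁻¹' (Φ '' closedBall 0 (3 / 4)))) :
    ∃ p ∈ ball (0 : V) (1 / 2), ∃ H : I × E → X, Continuous H ∧ (∀ t, H (0, t) = α t) ∧
      (∀ s t, α t ∉ Φ '' ball 0 1 → H (s, t) = α t) ∧
      (∀ s t, α t ∈ Φ '' ball 0 1 → H (s, t) ∈ Φ '' ball 0 1) ∧ ∀ t, H (1, t) ≠ Φ p := by
  classical
  set U := α ⁻¹' (Φ '' ball 0 1) with hUdef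
  set A := α ⁻¹' (Φ '' closedBall 0 (3 / 4)) with hAdef
  have hAU : A ⊆ U := preimage_mono (image_mono (closedBall_subset_ball (by norm_num)))
  set u : E → V := fun t => Ψ (α t) with hu
  have huc : ContinuousOn u U := hΨ.comp hα.continuousOn fun t ht => ht
  have hub : ∀ t ∈ U, ‖u t‖ < 1 ∧ Φ (u t) = α t := by
    rintro t ⟨y, hy, hyt⟩
    have : u t = y := by rw [← hΨΦ y hy, hyt]
    rw [this]
    exact ⟨by simpa using hy, hyt⟩
  have huA : ∀ t ∈ U, t ∉ A → 3 / 4 < ‖u t‖ := by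
    intro t ht htA
    by_contra! h
    exact htA ⟨u t, by simpa using h, (hub t ht).2⟩
  obtain ⟨g, hg⟩ := ContinuousMap.exists_restrict_eq hA
    (⟨fun t => u t, (huc.mono hAU).domRestrict⟩ : C(A, V))
  have hgu : ∀ t ∈ A, g t = u t := fun t ht => congrArg (fun F : C(A, V) => F ⟨t, ht⟩) hg
  obtain ⟨v, hv, hvg, -⟩ := g.continuous.exists_contDiff_approx 1 (ε := fun _ => 1 / 8)
    continuous_const (by norm_num)
  obtain ⟨p, hpv, hp⟩ := (hv.dense_compl_range_of_finrank_lt_finrank hEV).exists_dist_lt 0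
    (show (0 : ℝ) < 1 / 4 by norm_num)
  rw [dist_zero_left] at hp
  let w : I × E → V := fun q =>
    u q.2 + ((q.1 : ℝ) * max 0 (min 1 (3 - 4 * ‖u q.2‖))) • (v q.2 - u q.2)
  have hwnear : ∀ s t, t ∈ A → dist (w (s, t)) (u t) < 1 / 8 := by
    intro s t ht
    have h1 : ‖v t - u t‖ < 1 / 8 := by rw [← hgu t ht, ← dist_eq_norm]; exact hvg t
    have h2 : 0 ≤ max 0 (min 1 (3 - 4 * ‖u t‖)) := le_max_left _ _
    have h3 : max 0 (min 1 (3 - 4 * ‖u t‖)) ≤ 1 := max_le zero_le_one (min_le_left _ _)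
    have h4 : (s : ℝ) * max 0 (min 1 (3 - 4 * ‖u t‖)) ≤ 1 := mul_le_one₀ s.2.2 h2 h3
    have h5 := mul_nonneg s.2.1 h2
    simp only [w]
    rw [dist_eq_norm, add_sub_cancel_left, norm_smul, Real.norm_of_nonneg h5]
    exact (mul_le_of_le_one_left (norm_nonneg _) h4).trans_lt h1
  have hwfar : ∀ s t, 3 / 4 ≤ ‖u t‖ → w (s, t) = u t := by
    intro s t h
    have : max 0 (min 1 (3 - 4 * ‖u t‖)) = 0 :=
      max_eq_left ((min_le_right _ _).trans (by linarith))
    simp [w, this]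
  have hwb : ∀ s t, t ∈ U → w (s, t) ∈ ball (0 : V) 1 := by
    intro s t ht
    rw [mem_ball_zero_iff]
    by_cases h : 3 / 4 ≤ ‖u t‖
    · rw [hwfar s t h]
      exact (hub t ht).1
    · have htA : t ∈ A := by
        by_contra htA
        exact h (huA t ht htA).le
      have h1 := hwnear s t htA
      rw [dist_eq_norm] at h1
      have h2 := norm_sub_norm_le (w (s, t)) (u t)
      linarith
  let H : I × E → X := fun q => if q.2 ∈ U then Φ (w q) else α q.2
  have hHU : ∀ q : I × E, q.2 ∈ U → H q = Φ (w q) := fun q hq => if_pos hq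
  have hHA : ∀ q : I × E, q.2 ∉ A → H q = α q.2 := by
    rintro ⟨s, t⟩ hq
    by_cases ht : t ∈ U
    · rw [hHU _ ht, hwfar s t (huA t ht hq).le]
      exact (hub t ht).2
    · exact if_neg ht
  refine ⟨p, by rw [mem_ball_zero_iff]; linarith, H, ?_, fun t => ?_, fun s t ht => if_neg ht,
    fun s t ht => ?_, fun t ht => ?_⟩
  · rw [continuous_iff_continuousAt]
    intro q
    by_cases hq : q.2 ∈ U
    · have hopen : IsOpen ((Prod.snd : I × E → E) ⁻¹' U) := hU.preimage continuous_snd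
      have hu2 : ContinuousOn (fun q : I × E => u q.2) (Prod.snd ⁻¹' U) :=
        huc.comp continuousOn_snd fun q hq => hq
      have hv2 : Continuous fun q : I × E => v q.2 := hv.continuous.comp continuous_snd
      have hwc : ContinuousOn w (Prod.snd ⁻¹' U) := hu2.add
        (ContinuousOn.smul (ContinuousOn.mul (by fun_prop) (continuousOn_const.sup
          (continuousOn_const.inf (continuousOn_const.sub (continuousOn_const.mul hu2.norm)))))
          (hv2.continuousOn.sub hu2))
      exact ((hΦ.comp hwc fun q hq => hwb q.1 q.2 hq).congr hHU).continuousAt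
        (hopen.mem_nhds hq)
    · have hopen : IsOpen ((Prod.snd : I × E → E) ⁻¹' Aᶜ) :=
        hA.isOpen_compl.preimage continuous_snd
      exact ((hα.comp continuous_snd).continuousOn.congr (s := Prod.snd ⁻¹' Aᶜ) hHA).continuousAt
        (hopen.mem_nhds fun h => hq (hAU h))
  · by_cases ht : t ∈ U
    · rw [hHU _ ht, ← (hub t ht).2]
      simp [w]
    · exact if_neg ht
  · rw [hHU (s, t) ht]
    exact ⟨_, hwb s t ht, rfl⟩
  · have hpb : p ∈ ball (0 : V) 1 := by rw [mem_ball_zero_iff]; linarith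
    by_cases htU : t ∈ U
    · rw [hHU _ htU] at ht
      have hwp : w (1, t) = p := by
        rw [← hΨΦ _ (hwb 1 t htU), ht, hΨΦ p hpb]
      by_cases h : ‖u t‖ ≤ 1 / 2
      · refine hpv ⟨t, ?_⟩
        rw [← hwp]
        have : max 0 (min 1 (3 - 4 * ‖u t‖)) = 1 := by
          rw [min_eq_left (by linarith), max_eq_right zero_le_one]
        simp [w, this]
      · by_cases h' : 3 / 4 ≤ ‖u t‖
        · rw [hwfar 1 t h'] at hwp
          rw [hwp] at h'
          linarith
        · have htA : t ∈ A := by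
            by_contra htA
            exact h' (huA t htU htA).le
          have h1 := hwnear 1 t htA
          rw [hwp, dist_comm, dist_eq_norm] at h1
          have h2 := norm_sub_norm_le (u t) p
          linarith
    · exact htU (by rw [hUdef, mem_preimage, ← show H (1, t) = α t from if_neg htU, ht]
                    exact ⟨p, hpb, rfl⟩)

/-- The radial deformation of a punctured ball into its sphere. -/
theorem exists_deformation_sphere {V : Type*} [NormedAddCommGroup V] [NormedSpace ℝ V] {p : V}
    (hp : p ∈ ball (0 : V) (1 / 2)) :
    ∃ F : I × V → V, ContinuousOn F (univ ×ˢ (closedBall 0 1 \ {p})) ∧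
      (∀ y, F (0, y) = y) ∧ (∀ s, ∀ y ∈ sphere (0 : V) 1, F (s, y) = y) ∧
      (∀ s, ∀ y ∈ closedBall (0 : V) 1 \ {p}, F (s, y) ∈ closedBall (0 : V) 1) ∧
      ∀ y ∈ closedBall (0 : V) 1 \ {p}, F (1, y) ∈ sphere (0 : V) 1 := by
  rw [mem_ball_zero_iff] at hp
  let θ : V → V := fun y => y - ((1 - ‖y‖) / (1 - ‖p‖)) • p
  have hθ : Continuous θ := by fun_prop
  have hθ0 : ∀ y ∈ closedBall (0 : V) 1 \ {p}, θ y ≠ 0 := by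
    rintro y ⟨hy, hyp⟩ h
    rw [mem_closedBall_zero_iff] at hy
    have h1 : y = ((1 - ‖y‖) / (1 - ‖p‖)) • p := sub_eq_zero.1 h
    have h2 : ‖y‖ = ((1 - ‖y‖) / (1 - ‖p‖)) * ‖p‖ := by
      conv_lhs => rw [h1]
      rw [norm_smul, Real.norm_of_nonneg (div_nonneg (by linarith) (by linarith))]
    have h3 : (1 : ℝ) - ‖p‖ ≠ 0 := by linarith
    have h4 : ‖y‖ = ‖p‖ := by
      field_simp at h2
      linarith
    rw [h4, div_self h3, one_smul] at h1
    exact hyp h1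
  have hθs : ∀ y ∈ sphere (0 : V) 1, θ y = y := fun y hy => by
    rw [mem_sphere_zero_iff_norm] at hy
    simp [θ, hy]
  let ν : V → V := fun y => ‖θ y‖⁻¹ • θ y
  have hν : ∀ y ∈ closedBall (0 : V) 1 \ {p}, ‖ν y‖ = 1 := fun y hy => by
    rw [norm_smul, norm_inv, norm_norm, inv_mul_cancel₀ (norm_ne_zero_iff.2 (hθ0 y hy))]
  refine ⟨fun q => (1 - (q.1 : ℝ)) • q.2 + (q.1 : ℝ) • ν q.2, ?_, fun y => by simp,
    fun s y hy => ?_, fun s y hy => ?_, fun y hy => ?_⟩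
  · have hθc : ContinuousOn (fun q : I × V => θ q.2) (univ ×ˢ (closedBall 0 1 \ {p})) :=
      (hθ.comp continuous_snd).continuousOn
    exact ContinuousOn.add (by fun_prop) (ContinuousOn.smul (by fun_prop)
      ((hθc.norm.inv₀ fun q hq => norm_ne_zero_iff.2 (hθ0 q.2 hq.2)).smul hθc))
  · have : ν y = y := by
      simp only [ν]
      rw [hθs y hy, mem_sphere_zero_iff_norm.1 hy]
      simp
    simp only [this]
    rw [← add_smul]
    simp
  · exact convex_closedBall (0 : V) 1 hy.1 (by simpa using (hν y hy).le)
      (by linarith [s.2.2]) s.2.1 (by ring)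
  · simpa using hν y hy

end CellPush

namespace CWStructure

variable {X : Type} [TopologicalSpace X] (S : CWStructure X)

theorem target_eq {d : ℕ} (i : S.cell d) : (S.map d i).target = S.map d i '' ball 0 1 := by
  rw [← S.source_eq d i, (S.map d i).image_source_eq_target]

variable [T2Space X]

/-- A compact set in the union of a cell and a closed set containing its boundary can be
deformed off the cell if it misses a point of the cell close to the centre. -/
theorem exists_deformation_of_cell {d : ℕ} (i : S.cell d) {K C : Set X} (hK : IsClosed K)
    (hKs : S.map d i '' sphere 0 1 ⊆ K) (hKb : Disjoint K (S.map d i '' ball 0 1))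
    (hC : IsClosed C) (hCK : C ⊆ K ∪ S.map d i '' ball 0 1) {p : Fin d → ℝ}
    (hp : p ∈ ball 0 (1 / 2)) (hpC : S.map d i p ∉ C) :
    ∃ G : I × X → X, ContinuousOn G (univ ×ˢ C) ∧ (∀ x, G (0, x) = x) ∧
      (∀ s, ∀ x ∈ K, G (s, x) = x) ∧ ∀ x ∈ C, G (1, x) ∈ K := by
  classical
  set Φ := S.map d i with hΦdef
  have hΦ : ContinuousOn Φ (closedBall 0 1) := S.continuousOn d i
  obtain ⟨F, hF, hF0, hFs, hFb, hF1⟩ := exists_deformation_sphere hp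
  have hpb : p ∈ ball (0 : Fin d → ℝ) 1 := ball_subset_ball (by norm_num) hp
  obtain ⟨δ, hδ, hδC⟩ : ∃ δ > 0, ∀ y ∈ ball p δ, Φ y ∉ C := by
    have : ContinuousAt Φ p := hΦ.continuousAt (closedBall_mem_nhds_of_mem hpb)
    exact Metric.eventually_nhds_iff_ball.1 (this.eventually (hC.isOpen_compl.mem_nhds hpC))
  set D := closedBall (0 : Fin d → ℝ) 1 \ ball p δ with hDdef
  have hDp : D ⊆ closedBall 0 1 \ {p} :=
    sdiff_subset_sdiff_right (singleton_subset_iff.2 (mem_ball_self hδ))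
  have hDc : IsCompact D := (isCompact_closedBall 0 1).diff isOpen_ball
  let G : I × X → X := fun q => if q.2 ∈ Φ '' ball 0 1 then Φ (F (q.1, Φ.symm q.2)) else q.2
  have hGK : ∀ s, ∀ x ∈ K, G (s, x) = x := fun s x hx =>
    if_neg fun h => hKb.le_bot ⟨hx, h⟩
  have hGb : ∀ s, ∀ y ∈ ball (0 : Fin d → ℝ) 1, G (s, Φ y) = Φ (F (s, y)) := fun s y hy => by
    simp only [G]
    rw [if_pos ⟨y, hy, rfl⟩, S.symm_map_apply hy]
  have hGD : ∀ s, ∀ y ∈ closedBall (0 : Fin d → ℝ) 1, G (s, Φ y) = Φ (F (s, y)) := by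
    intro s y hy
    rw [← ball_union_sphere] at hy
    rcases hy with hy | hy
    · exact hGb s y hy
    · rw [hGK s _ (hKs ⟨y, hy, rfl⟩), hFs s y hy]
  have hCD : C ⊆ K ∪ Φ '' D := by
    intro x hx
    rcases hCK hx with h | ⟨y, hy, rfl⟩
    · exact .inl h
    · exact .inr ⟨y, ⟨ball_subset_closedBall hy, fun h => hδC y h hx⟩, rfl⟩
  refine ⟨G, ?_, fun x => ?_, hGK, fun x hx => ?_⟩
  · have h1 : ContinuousOn G (univ ×ˢ K) :=
      continuousOn_snd.congr fun q hq => hGK q.1 q.2 hq.2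
    have h2 : ContinuousOn G (univ ×ˢ (Φ '' D)) := by
      have hΦ2 : ContinuousOn (Prod.map id Φ : I × (Fin d → ℝ) → I × X) (univ ×ˢ D) :=
        continuousOn_id.prodMap (hΦ.mono sdiff_subset)
      have := (isCompact_univ.prod hDc).continuousOn_image hΦ2 (F := G)
        ((hΦ.comp (hF.mono (prod_mono_right hDp)) fun q hq => hFb q.1 q.2 (hDp hq.2)).congr
          fun q hq => hGD q.1 q.2 hq.2.1)
      rwa [prodMap_image_prod, image_id] at this
    refine (h1.union_of_isClosed h2 (isClosed_univ.prod hK) (isClosed_univ.prod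
      (hDc.image_of_continuousOn (hΦ.mono sdiff_subset)).isClosed)).mono ?_
    rw [← prod_union]
    exact prod_mono_right hCD
  · by_cases hx : x ∈ Φ '' ball 0 1
    · obtain ⟨y, hy, rfl⟩ := hx
      rw [hGb 0 y hy, hF0]
    · exact if_neg hx
  · rcases hCD hx with h | ⟨y, hy, rfl⟩
    · rwa [hGK 1 x h]
    · rw [hGD 1 y hy.1]
      exact hKs ⟨_, hF1 y (hDp hy), rfl⟩

/-- A map of a cube can be deformed off a cell of larger dimension. -/
theorem exists_homotopicRel_of_cell {n d : ℕ} (hnd : n < d) (i : S.cell d) {K : Set X}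
    (hK : IsClosed K) (hKs : S.map d i '' sphere 0 1 ⊆ K)
    (hKb : Disjoint K (S.map d i '' ball 0 1)) (α : C(Fin n → I, X))
    (hα : ∀ t, α t ∈ K ∪ S.map d i '' ball 0 1) :
    ∃ α' : C(Fin n → I, X), α.HomotopicRel α' (α ⁻¹' K) ∧ ∀ t, α' t ∈ K := by
  set Φ := S.map d i with hΦdef
  have hΦ : ContinuousOn Φ (closedBall 0 1) := S.continuousOn d i
  let r : (Fin n → ℝ) → Fin n → I := fun t j => projIcc 0 1 zero_le_one (t j)
  have hr : Continuous r := continuous_pi fun j => continuous_projIcc.comp (continuous_apply j)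
  let ι : (Fin n → I) → Fin n → ℝ := fun t j => t j
  have hι : Continuous ι := by fun_prop
  have hrι : ∀ t, r (ι t) = t := fun t => funext fun j => projIcc_val zero_le_one (t j)
  obtain ⟨p, hp, H, hH, hH0, hHK, hHb, hHp⟩ := exists_homotopy_notMem_range
    (E := Fin n → ℝ) (V := Fin d → ℝ) (by simpa using hnd) (hΦ.mono ball_subset_closedBall)
    (by rw [hΦdef, ← S.target_eq i]; exact S.continuousOn_symm d i)
    (fun y hy => S.symm_map_apply hy) (α.continuous.comp hr)
    (by
      have : (α ∘ r) ⁻¹' (Φ '' ball 0 1) = ((α ∘ r) ⁻¹' K)ᶜ := by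
        ext t
        exact ⟨fun h h' => hKb.le_bot ⟨h', h⟩, fun h => (hα (r t)).resolve_left h⟩
      rw [this]
      exact (hK.preimage (α.continuous.comp hr)).isOpen_compl)
    (((isCompact_closedBall 0 (3 / 4)).image_of_continuousOn
      (hΦ.mono (closedBall_subset_closedBall (by norm_num)))).isClosed.preimage
        (α.continuous.comp hr))
  have hKn : ∀ t, α t ∈ K → (α ∘ r) (ι t) ∉ Φ '' ball 0 1 := fun t ht h => by
    rw [comp_apply, hrι] at h
    exact hKb.le_bot ⟨ht, h⟩
  let β : C(Fin n → I, X) := ⟨fun t => H (1, ι t), by fun_prop⟩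
  have h1 : α.HomotopicRel β (α ⁻¹' K) := by
    refine ⟨⟨⟨⟨fun q => H (q.1, ι q.2), by fun_prop⟩, fun t => ?_, fun t => rfl⟩,
      fun s t ht => ?_⟩⟩
    · change H (0, ι t) = α t
      rw [hH0, comp_apply, hrι]
    · change H (s, ι t) = α t
      rw [hHK s _ (hKn t ht), comp_apply, hrι]
  have hβK : ∀ t, α t ∈ K → β t = α t := fun t ht => by
    change H (1, ι t) = α t
    rw [hHK 1 _ (hKn t ht), comp_apply, hrι]
  have hβ : range β ⊆ K ∪ Φ '' ball 0 1 := by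
    rintro _ ⟨t, rfl⟩
    rcases hα t with h | h
    · exact .inl (by rwa [hβK t h])
    · exact .inr (hHb 1 (ι t) (by rwa [comp_apply, hrι]))
  obtain ⟨G, hG, hG0, hGK, hG1⟩ := S.exists_deformation_of_cell i hK hKs hKb
    (isCompact_range β.continuous).isClosed hβ hp (by
      rintro ⟨t, ht⟩
      exact hHp (ι t) ht)
  have hGβ : Continuous fun q : I × (Fin n → I) => G (q.1, β q.2) :=
    hG.comp_continuous (by fun_prop) fun q => ⟨mem_univ _, mem_range_self _⟩
  let α' : C(Fin n → I, X) := ⟨fun t => G (1, β t),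
    hGβ.comp (f := fun t => ((1 : I), t)) (by fun_prop)⟩
  refine ⟨α', h1.trans ⟨⟨⟨⟨_, hGβ⟩, fun t => hG0 _, fun t => rfl⟩, fun s t ht => ?_⟩⟩,
    fun t => hG1 _ (mem_range_self t)⟩
  exact hGK s _ (by rw [hβK t ht]; exact ht)

end CWStructure

namespace CWStructure

variable {X : Type} [TopologicalSpace X] (S : CWStructure X)

theorem finite_openCells_inter_closedCell (n : ℕ) (i : S.cell n) :
    {c : Σ n, S.cell n |
      (S.map n i '' closedBall 0 1 ∩ S.map c.1 c.2 '' ball 0 1).Nonempty}.Finite := by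
  induction n using Nat.strong_induction_on with
  | _ n ih =>
    obtain ⟨J, hJ⟩ := S.mapsTo n i
    refine ((finite_singleton (⟨n, i⟩ : Σ n, S.cell n)).union (finite_iUnion
      fun q : Σ m : Fin n, J m => ih q.1 q.1.2 q.2)).subset ?_
    rintro c ⟨_, ⟨y, hy, rfl⟩, hc⟩
    rw [← ball_union_sphere] at hy
    rcases hy with hy | hy
    · exact .inl (S.openCell_index_eq hc ⟨y, hy, rfl⟩)
    · have := hJ hy
      simp only [mem_iUnion] at this
      obtain ⟨m, hm, j, hj, h⟩ := this
      exact .inr (mem_iUnion.2 ⟨⟨⟨m, hm⟩, ⟨j, hj⟩⟩, _, h, hc⟩)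

theorem exists_mem_openCell (x : X) : ∃ c : Σ n, S.cell n, x ∈ S.map c.1 c.2 '' ball 0 1 := by
  have : x ∈ ⋃ (n : ℕ), ⋃ (i : S.cell n), S.map n i '' closedBall 0 1 := by
    rw [S.union']; trivial
  simp only [mem_iUnion] at this
  obtain ⟨n, i, h⟩ := this
  obtain ⟨m, -, j, hj⟩ := S.exists_mem_openCell_of_mem_closedCell h
  exact ⟨⟨m, j⟩, hj⟩

/-- A compact set meets only finitely many open cells. -/
theorem finite_openCells_inter_isCompact [T2Space X] {C : Set X} (hC : IsCompact C) :
    {c : Σ n, S.cell n | (C ∩ S.map c.1 c.2 '' ball 0 1).Nonempty}.Finite := by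
  set T := {c : Σ n, S.cell n | (C ∩ S.map c.1 c.2 '' ball 0 1).Nonempty} with hT
  choose g hg using fun c : T => c.2
  have hginj : Injective g := fun a b hab =>
    Subtype.ext (S.openCell_index_eq (hg a).2 (by rw [hab]; exact (hg b).2))
  have hclosed : ∀ Q ⊆ range g, IsClosed Q := by
    intro Q hQ
    refine S.closed' _ fun n i => Set.Finite.isClosed ?_
    refine (((S.finite_openCells_inter_closedCell n i).preimage
      Subtype.val_injective.injOn).image g).subset ?_
    rintro x ⟨hx, hxi⟩
    obtain ⟨c, rfl⟩ := hQ hx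
    exact ⟨c, ⟨_, hxi, (hg c).2⟩, rfl⟩
  have hfin : (range g).Finite := by
    refine (hC.of_isClosed_subset (hclosed _ Subset.rfl) ?_).finite
      (isDiscrete_iff_forall_mem_exists_isClosed.2 fun Q hQ =>
        ⟨Q, hclosed Q hQ, inter_eq_left.2 hQ⟩)
    rintro _ ⟨c, rfl⟩
    exact (hg c).1
  have := hfin.to_subtype
  exact finite_coe_iff.1 (Finite.of_injective (rangeFactorization g) fun a b hab =>
    hginj (congrArg Subtype.val hab))

/-- The union of the closed cells indexed by `T`. -/
def carrier (T : Set (Σ n, S.cell n)) : Set X :=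
  ⋃ c ∈ T, S.map c.1 c.2 '' closedBall 0 1

theorem isClosed_carrier [T2Space X] {T : Set (Σ n, S.cell n)} (hT : T.Finite) :
    IsClosed (S.carrier T) :=
  hT.isClosed_biUnion fun c _ => (S.isCompact_closedCell c.1 c.2).isClosed

theorem mem_carrier {T : Set (Σ n, S.cell n)} {x : X} :
    x ∈ S.carrier T ↔ ∃ c ∈ T, x ∈ S.map c.1 c.2 '' closedBall 0 1 := by
  simp [carrier]

/-- **Cellular approximation** for maps of cubes with image in finitely many closed cells. -/
theorem exists_homotopicRel_carrier [T2Space X] {n : ℕ} {x₀ : X} (hx₀ : S.IsZeroCell x₀)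
    {A : Set (Fin n → I)} (N : ℕ) :
    ∀ (T : Set (Σ n, S.cell n)), T.Finite → (∀ c ∈ T, c.1 ≤ N) → ∀ α : C(Fin n → I, X),
      (∀ t ∈ A, α t = x₀) → (∀ t, α t ∈ S.carrier T) →
      ∃ α' : C(Fin n → I, X), α.HomotopicRel α' A ∧
        ∀ t, ∃ m ≤ n, ∃ i : S.cell m, α' t ∈ S.map m i '' closedBall 0 1 := by
  obtain ⟨i₀, hi₀⟩ := hx₀
  have hbase : ∀ N ≤ n, ∀ (T : Set (Σ n, S.cell n)), T.Finite → (∀ c ∈ T, c.1 ≤ N) →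
      ∀ α : C(Fin n → I, X), (∀ t ∈ A, α t = x₀) → (∀ t, α t ∈ S.carrier T) →
      ∃ α' : C(Fin n → I, X), α.HomotopicRel α' A ∧
        ∀ t, ∃ m ≤ n, ∃ i : S.cell m, α' t ∈ S.map m i '' closedBall 0 1 := by
    intro N hN T _ hTN α _ hα
    refine ⟨α, .refl α, fun t => ?_⟩
    obtain ⟨c, hc, h⟩ := S.mem_carrier.1 (hα t)
    exact ⟨c.1, (hTN c hc).trans hN, c.2, h⟩
  induction N with
  | zero => exact hbase 0 n.zero_le
  | succ N ih =>
    by_cases hN : N + 1 ≤ n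
    · exact hbase _ hN
    suffices key : ∀ T' : Set (Σ n, S.cell n), T'.Finite → (∀ c ∈ T', c.1 = N + 1) →
        ∀ T : Set (Σ n, S.cell n), T.Finite → (∀ c ∈ T, c.1 ≤ N) →
        ∀ α : C(Fin n → I, X), (∀ t ∈ A, α t = x₀) → (∀ t, α t ∈ S.carrier (T' ∪ T)) →
        ∃ α' : C(Fin n → I, X), α.HomotopicRel α' A ∧
          ∀ t, ∃ m ≤ n, ∃ i : S.cell m, α' t ∈ S.map m i '' closedBall 0 1 by
      intro T hT hTN α hA hα
      refine key {c ∈ T | c.1 = N + 1} (hT.subset (sep_subset _ _)) (fun c hc => hc.2)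
        {c ∈ T | c.1 ≤ N} (hT.subset (sep_subset _ _)) (fun c hc => hc.2) α hA fun t => ?_
      obtain ⟨c, hc, h⟩ := S.mem_carrier.1 (hα t)
      refine S.mem_carrier.2 ⟨c, ?_, h⟩
      rcases (hTN c hc).eq_or_lt with h | h
      · exact .inl ⟨hc, h⟩
      · exact .inr ⟨hc, Nat.lt_succ_iff.1 h⟩
    intro T' hT'
    induction T', hT' using Set.Finite.induction_on with
    | empty =>
      intro _ T hT hTN α hA hα
      rw [empty_union] at hα
      exact ih T hT hTN α hA hα
    | @insert e T' heT' hT' ihT' =>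
      intro hT'N T hT hTN α hA hα
      obtain ⟨d, i⟩ := e
      obtain rfl : d = N + 1 := hT'N _ (mem_insert _ _)
      obtain ⟨J, hJ⟩ := S.mapsTo (N + 1) i
      let T₁ : Set (Σ n, S.cell n) :=
        T ∪ range fun q : Σ m : Fin (N + 1), J m => (⟨q.1, q.2⟩ : Σ n, S.cell n)
      have hT₁ : T₁.Finite := hT.union (finite_range _)
      have hT₁N : ∀ c ∈ T₁, c.1 ≤ N := by
        rintro c (hc | ⟨q, rfl⟩)
        · exact hTN c hc
        · exact Nat.lt_succ_iff.1 q.1.2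
      have hs : S.map (N + 1) i '' sphere 0 1 ⊆ S.carrier (T' ∪ T₁) := by
        rintro _ ⟨y, hy, rfl⟩
        have := hJ hy
        simp only [mem_iUnion] at this
        obtain ⟨m, hm, j, hj, h⟩ := this
        exact S.mem_carrier.2 ⟨⟨m, j⟩, .inr (.inr ⟨⟨⟨m, hm⟩, ⟨j, hj⟩⟩, rfl⟩), h⟩
      have hlow : ∀ c : Σ n, S.cell n, c.1 ≤ N → ∀ x ∈ S.map c.1 c.2 '' closedBall 0 1,
          x ∉ S.map (N + 1) i '' ball 0 1 := fun c hc x hx =>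
        S.notMem_openCell_of_mem_closedCell (Nat.lt_succ_iff.2 hc) hx i
      have hdisj : Disjoint (S.carrier (T' ∪ T₁)) (S.map (N + 1) i '' ball 0 1) := by
        rw [Set.disjoint_left]
        intro x hx hxi
        obtain ⟨c, hc | hc, h⟩ := S.mem_carrier.1 hx
        · obtain ⟨d, j⟩ := c
          obtain rfl : d = N + 1 := hT'N _ (mem_insert_of_mem _ hc)
          obtain ⟨y, hy, rfl⟩ := h
          rw [← ball_union_sphere] at hy
          rcases hy with hy | hy
          · have := S.openCell_index_eq ⟨y, hy, rfl⟩ hxi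
            exact heT' (this ▸ hc)
          · obtain ⟨J', hJ'⟩ := S.mapsTo (N + 1) j
            have := hJ' hy
            simp only [mem_iUnion] at this
            obtain ⟨m, hm, k, hk, h⟩ := this
            exact hlow ⟨m, k⟩ (Nat.lt_succ_iff.1 hm) _ h hxi
        · exact hlow c (hT₁N c hc) x h hxi
      have hα' : ∀ t, α t ∈ S.carrier (T' ∪ T₁) ∪ S.map (N + 1) i '' ball 0 1 := by
        intro t
        obtain ⟨c, hc, h⟩ := S.mem_carrier.1 (hα t)
        rcases hc with (rfl | hc) | hc
        · obtain ⟨y, hy, hyt⟩ := h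
          rw [← ball_union_sphere] at hy
          rcases hy with hy | hy
          · exact .inr ⟨y, hy, hyt⟩
          · exact .inl (hs ⟨y, hy, hyt⟩)
        · exact .inl (S.mem_carrier.2 ⟨c, .inl hc, h⟩)
        · exact .inl (S.mem_carrier.2 ⟨c, .inr (.inl hc), h⟩)
      obtain ⟨β, hβ, hβK⟩ := S.exists_homotopicRel_of_cell (by lia : n < N + 1) i
        (S.isClosed_carrier (hT'.union hT₁)) hs hdisj α hα'
      have hAK : A ⊆ α ⁻¹' S.carrier (T' ∪ T₁) := by
        intro t ht
        refine (hα' t).resolve_right ?_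
        rw [hA t ht]
        exact hlow ⟨0, i₀⟩ N.zero_le _ ⟨0, by simp, hi₀⟩
      have hβA : α.HomotopicRel β A :=
        hβ.elim fun F => ⟨⟨F.toHomotopy, fun s t ht => F.eq_fst s (hAK ht)⟩⟩
      obtain ⟨γ, hγ, hγn⟩ := ihT' (fun c hc => hT'N c (mem_insert_of_mem _ hc)) T₁ hT₁ hT₁N β
        (fun t ht => by
          obtain ⟨F⟩ := hβA
          rw [← hA t ht]
          exact (F.fst_eq_snd ht).symm) hβK
      exact ⟨γ, hβA.trans hγ, hγn⟩

/-- **Cellular approximation** for generalized loops. -/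
theorem exists_genLoop_homotopic [T2Space X] {n : ℕ} {x₀ : X} (hx₀ : S.IsZeroCell x₀)
    (p : GenLoop (Fin n) X x₀) : ∃ q : GenLoop (Fin n) X x₀, GenLoop.Homotopic p q ∧
      ∀ t, ∃ m ≤ n, ∃ i : S.cell m, q t ∈ S.map m i '' closedBall 0 1 := by
  have hT := S.finite_openCells_inter_isCompact (isCompact_range p.1.continuous)
  obtain ⟨N, hN⟩ := (hT.image Sigma.fst).bddAbove
  obtain ⟨α, hα, hαn⟩ := S.exists_homotopicRel_carrier hx₀ (A := Cube.boundary (Fin n)) N _ hT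
    (fun c hc => hN ⟨c, hc, rfl⟩) p.1 p.2 fun t => by
      obtain ⟨c, hc⟩ := S.exists_mem_openCell (p.1 t)
      exact S.mem_carrier.2 ⟨c, ⟨_, mem_range_self t, hc⟩, image_mono ball_subset_closedBall hc⟩
  refine ⟨⟨α, fun t ht => ?_⟩, hα, hαn⟩
  obtain ⟨F⟩ := hα
  rw [← p.2 t ht]
  exact (F.fst_eq_snd ht).symm

theorem surjective_map_incl [T2Space X] {x₀ : X} (hx₀ : S.IsZeroCell x₀) {M : Set X}
    (hM : S.LowCellsIn M) (hx₀M : x₀ ∈ M) {n : ℕ} (hn : n < 4) :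
    Surjective (HomotopyGroup.map (Fin n) M.incl (x := ⟨x₀, hx₀M⟩) (y := x₀) rfl) := by
  intro p
  induction p using Quotient.inductionOn with | _ p
  obtain ⟨q, hpq, hq⟩ := S.exists_genLoop_homotopic hx₀ p
  have hqM : ∀ t, q t ∈ M := fun t => by
    obtain ⟨m, hm, i, h⟩ := hq t
    exact hM m (hm.trans_lt hn) i h
  let q' : GenLoop (Fin n) M ⟨x₀, hx₀M⟩ :=
    ⟨⟨fun t => ⟨q t, hqM t⟩, q.1.continuous.subtype_mk _⟩, fun t ht => Subtype.ext (q.2 t ht)⟩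
  exact ⟨Quotient.mk _ q', Quotient.sound hpq.symm⟩

end CWStructure

/-- If `B` is a CW complex whose cells not contained in the path-connected
subcomplex `M` have dimension at least `4`, `B` is path-connected with
`πₙ(B) = 0` for `n ≥ 3`, and `f : M → B` is a pointed map inducing isomorphisms
on `π₁` and `π₂`, then every continuous `φ : B → B` with `φ|_M = f` is a
homotopy equivalence. -/
theorem extension_is_homotopy_equivalence {B : Type} [TopologicalSpace B] [T2Space B]
    [PathConnectedSpace B]
    (S : CWStructure B) (M : Set B) (hM : CWSubcomplex S M)
    (hcells : S.LowCellsIn M)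
    (b₀ : B) (hb₀ : b₀ ∈ M) (hb₀cell : S.IsZeroCell b₀)
    (hMconn : IsPathConnected M)
    (hπ : ∀ n : ℕ, 3 ≤ n → Subsingleton (HomotopyGroup (Fin n) B b₀))
    (f : C(M, B)) (hf : f ⟨b₀, hb₀⟩ = b₀)
    (hf1 : Function.Bijective (HomotopyGroup.map (Fin 1) f hf))
    (hf2 : Function.Bijective (HomotopyGroup.map (Fin 2) f hf))
    (φ : C(B, B)) (hφ : ∀ m : M, φ m = f m) :
    ∃ ψ : C(B, B), (ψ.comp φ).Homotopic (ContinuousMap.id B) ∧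
      (φ.comp ψ).Homotopic (ContinuousMap.id B) := by
  have hφ₀ : φ b₀ = b₀ := (hφ ⟨b₀, hb₀⟩).trans hf
  have hlow : ∀ n < 4, Function.Bijective (HomotopyGroup.map (Fin n) f hf) →
      Function.Bijective (HomotopyGroup.map (Fin n) φ hφ₀) := by
    intro n hn H
    have hsurj := S.surjective_map_incl hb₀cell hcells hb₀ hn
    obtain rfl : φ.comp M.incl = f := ContinuousMap.ext hφ
    have hcomp : HomotopyGroup.map (Fin n) φ hφ₀ ∘
        HomotopyGroup.map (Fin n) M.incl (x := ⟨b₀, hb₀⟩) rfl =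
          HomotopyGroup.map (Fin n) (φ.comp M.incl) hf :=
      funext fun p => HomotopyGroup.map_map _ _ _ _ _ p
    rw [← hcomp] at H
    exact (Function.Bijective.of_comp_iff _ ⟨H.1.of_comp, hsurj⟩).1 H
  refine S.exists_homotopy_inverse hb₀cell φ hφ₀ fun n => ?_
  have htriv : Subsingleton (HomotopyGroup (Fin n) B b₀) →
      Function.Bijective (HomotopyGroup.map (Fin n) φ hφ₀) := fun _ =>
    ⟨Function.injective_of_subsingleton _, fun p => ⟨p, Subsingleton.elim _ _⟩⟩
  match n with
  | 0 => exact htriv (HomotopyGroup.subsingleton_of_isEmpty b₀)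
  | 1 => exact hlow 1 (by norm_num) hf1
  | 2 => exact hlow 2 (by norm_num) hf2
  | n + 3 => exact htriv (hπ (n + 3) (by lia))
end

section
/- Let G be a group acting on an abelian group A by automorphisms (written g•a), and let α : G → A satisfy α(f g) = α(f) + f•α(g) for all f, g ∈ G. Let K be a normal subgroup of G such that every element of K acts trivially on A, the restriction α|_K : K → A is a bijection, and the quotient homomorphism p : G → G/K admits a group homomorphism section s : G/K → G with p∘s = id. Then the G-action on A descends to an action of G/K on A, and G is isomorphic to the semidirect product A ⋊ (G/K) with respect to this action, via an isomorphism whose restriction to K is α|_K onto the subgroup A × {1}. -/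
/-- An action of `G` on an additive group `A` in which the normal subgroup `K` acts trivially
descends to an action of `G ⧸ K` by automorphisms. -/
def quotientMulAut {G A : Type*} [Group G] [AddCommGroup A] [DistribMulAction G A]
    (K : Subgroup G) [K.Normal] (htriv : ∀ k ∈ K, ∀ a : A, k • a = a) :
    G ⧸ K →* MulAut (Multiplicative A) :=
  QuotientGroup.lift K
    { toFun := fun g => AddEquiv.toMultiplicative (DistribMulAction.toAddEquiv A g)
      map_one' := by
        ext a
        exact congrArg Multiplicative.ofAdd (one_smul G a.toAdd)
      map_mul' := fun f g => by
        ext a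
        exact congrArg Multiplicative.ofAdd (mul_smul f g a.toAdd) }
    (fun k hk => by
      ext a
      exact congrArg Multiplicative.ofAdd (htriv k hk a.toAdd))

/-- A crossed homomorphism `α` together with the quotient map is a homomorphism to the
semidirect product. -/
def crossedHomToSemidirect {G A : Type*} [Group G] [AddCommGroup A] [DistribMulAction G A]
    (α : G → A) (hα : ∀ f g : G, α (f * g) = α f + f • α g)
    (K : Subgroup G) [K.Normal] (htriv : ∀ k ∈ K, ∀ a : A, k • a = a) :
    G →* Multiplicative A ⋊[quotientMulAut K htriv] (G ⧸ K) :=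
  MonoidHom.mk' (fun g => ⟨Multiplicative.ofAdd (α g), QuotientGroup.mk g⟩)
    (fun f g => SemidirectProduct.ext (congrArg Multiplicative.ofAdd (hα f g)) rfl)

theorem crossedHomToSemidirect_bijective {G A : Type*} [Group G] [AddCommGroup A]
    [DistribMulAction G A] (α : G → A) (hα : ∀ f g : G, α (f * g) = α f + f • α g)
    (K : Subgroup G) [K.Normal] (htriv : ∀ k ∈ K, ∀ a : A, k • a = a)
    (hbij : Function.Bijective (fun k : K => α (k : G))) :
    Function.Bijective (crossedHomToSemidirect α hα K htriv) := by
  constructor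
  · rw [injective_iff_map_eq_one]
    intro g hg
    have hgK : g ∈ K := (QuotientGroup.eq_one_iff g).1 (congrArg SemidirectProduct.right hg)
    have hαg : α g = 0 := congrArg (fun x => Multiplicative.toAdd x.left) hg
    have hone : α 1 = 0 := by simpa using hα 1 1
    exact congrArg Subtype.val
      (hbij.1 (a₁ := ⟨g, hgK⟩) (a₂ := 1) (hαg.trans hone.symm))
  · rintro ⟨a, x⟩
    obtain ⟨g, rfl⟩ := QuotientGroup.mk_surjective x
    obtain ⟨k, hk⟩ := hbij.2 (g⁻¹ • (a.toAdd - α g))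
    refine ⟨g * k, SemidirectProduct.ext (congrArg Multiplicative.ofAdd ?_)
      (QuotientGroup.mk_mul_of_mem g k.2)⟩
    change α (g * k) = a.toAdd
    rw [hα, show α k = _ from hk, smul_inv_smul, add_sub_cancel]


/-- Splitting via a crossed homomorphism: if `α : G → A` is a crossed
homomorphism, `K ⊴ G` acts trivially on `A`, `α|_K : K → A` is a bijection, and
the quotient map `G → G/K` admits a group-homomorphism section `s`, then the
`G`-action descends to a `G/K`-action `φ` on `A`, and `G` is isomorphic to the
semidirect product `A ⋊[φ] (G/K)`, via an isomorphism carrying each `k ∈ K` to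
`(α k, 1)`, i.e. to the element `inl (α k)` of the subgroup `A × {1}`. -/
theorem crossed_hom_semidirect_splitting {G A : Type} [Group G] [AddCommGroup A]
    [DistribMulAction G A] (α : G → A)
    (hα : ∀ f g : G, α (f * g) = α f + f • α g)
    (K : Subgroup G) [K.Normal]
    (htriv : ∀ k ∈ K, ∀ a : A, k • a = a)
    (hbij : Function.Bijective (fun k : K => α (k : G)))
    (s : G ⧸ K →* G) (hs : ∀ x : G ⧸ K, QuotientGroup.mk (s x) = x) :
    ∃ φ : G ⧸ K →* MulAut (Multiplicative A),
      (∀ (g : G) (a : A),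
        φ (QuotientGroup.mk g) (Multiplicative.ofAdd a) = Multiplicative.ofAdd (g • a)) ∧
      ∃ e : G ≃* (Multiplicative A) ⋊[φ] (G ⧸ K),
        ∀ k ∈ K, e k = SemidirectProduct.inl (Multiplicative.ofAdd (α k)) := by
  refine ⟨quotientMulAut K htriv, fun _ _ => rfl,
    MulEquiv.ofBijective _ (crossedHomToSemidirect_bijective α hα K htriv hbij),
    fun k hk => SemidirectProduct.ext rfl ?_⟩
  exact (QuotientGroup.eq_one_iff k).2 hk
end
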